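/- Assume the family {P^u}_{u∈(a,b)} satisfies P1–P3 and S1–S2, and define the modified events 𝒜^u_x (with the additional axis-crossing condition (c)) and the corresponding recursive bad events and the modified notion of k-bad. Then for each u ∈ (a,b) there exist C = C(u) < ∞ and C′ = C′(u,l_0) < ∞ such that for all l_0, r_0 ≥ C, L_0 ≥ C′, and k ≥ 0: P^u[0 is k-bad] ≤ 2·2^{−2^k}. -/

import Mathlib

open MeasureTheory Filter
open scoped ENNReal

namespace Perco

/-- A point of the lattice `ℤ^d`. -/
abbrev Pt (d : ℕ) := Fin d → ℤ

/-- A percolation configuration on `ℤ^d`. -/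
abbrev Config (d : ℕ) := Pt d → Bool

variable {d : ℕ}

/-- The `ℓ¹`-distance on `ℤ^d`. -/
def dist1 (x y : Pt d) : ℕ := ∑ i, (x i - y i).natAbs

/-- The `ℓ^∞`-distance on `ℤ^d`. -/
def distInf (x y : Pt d) : ℕ := Finset.univ.sup fun i => (x i - y i).natAbs

/-- The closed `ℓ^∞`-ball of radius `R` around `x`. -/
def ballZ (x : Pt d) (R : ℕ) : Set (Pt d) := {y | distInf x y ≤ R}

/-- Nearest-neighbour adjacency in `ℤ^d`. -/
def adj (x y : Pt d) : Prop := dist1 x y = 1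

/-- The occupied set of a configuration. -/
def SS (ω : Config d) : Set (Pt d) := {x | ω x = true}

/-- One step of a nearest-neighbour path staying inside `T`. -/
def stepRel (T : Set (Pt d)) (x y : Pt d) : Prop := adj x y ∧ x ∈ T ∧ y ∈ T

/-- `x` and `y` are connected by a nearest-neighbour path inside `T`. -/
def connIn (T : Set (Pt d)) (x y : Pt d) : Prop :=
  x ∈ T ∧ y ∈ T ∧ Relation.ReflTransGen (stepRel T) x y

/-- The connected component (cluster) of `x` in `T`. -/
def cluster (T : Set (Pt d)) (x : Pt d) : Set (Pt d) := {y | connIn T x y}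

/-- `S_r`: vertices of `S(ω)` in connected components of `ℓ¹`-diameter at least `r`. -/
def Sr (ω : Config d) (r : ℝ) : Set (Pt d) :=
  {x | x ∈ SS ω ∧ ∃ y ∈ cluster (SS ω) x, ∃ z ∈ cluster (SS ω) x, r ≤ (dist1 y z : ℝ)}

/-- `S_∞`: vertices of `S(ω)` in infinite connected components. -/
def Sinf (ω : Config d) : Set (Pt d) := {x | x ∈ SS ω ∧ (cluster (SS ω) x).Infinite}

/-- The shift of a configuration by `x`. -/
def shift (x : Pt d) (ω : Config d) : Config d := fun y => ω (x + y)

/-- An increasing event. -/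
def IncreasingEvent (G : Set (Config d)) : Prop :=
  ∀ ω ω' : Config d, (∀ x, ω x = true → ω' x = true) → ω ∈ G → ω' ∈ G

/-- A decreasing event. -/
def DecreasingEvent (G : Set (Config d)) : Prop :=
  ∀ ω ω' : Config d, (∀ x, ω' x = true → ω x = true) → ω ∈ G → ω' ∈ G

/-- The event `G` depends only on the coordinates in `B`. -/
def DependsOn (G : Set (Config d)) (B : Set (Pt d)) : Prop :=
  ∀ ω ω' : Config d, (∀ x ∈ B, ω x = ω' x) → (ω ∈ G ↔ ω' ∈ G)

/-- The edge boundary of `A` in `Sset`: (directed representatives of) edges of `ℤ^d`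
with one endpoint in `A` and the other in `Sset \ A`. -/
def edgeBd (Sset A : Set (Pt d)) : Set (Pt d × Pt d) :=
  {p | adj p.1 p.2 ∧ p.1 ∈ A ∧ p.2 ∈ Sset \ A}

/-- The density `η(u) = P[0 ∈ S_∞]` of the infinite cluster. -/
noncomputable def eta (d : ℕ) (P : Measure (Config d)) : ℝ :=
  (P {ω | (0 : Pt d) ∈ Sinf ω}).toReal

/-- The first local-uniqueness event of axiom S1. -/
def locUniq1 (d : ℕ) (R : ℕ) : Set (Config d) :=
  {ω | (Sr ω R ∩ ballZ (0 : Pt d) R).Nonempty}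

/-- The second local-uniqueness event of axiom S1. -/
def locUniq2 (d : ℕ) (R : ℕ) : Set (Config d) :=
  {ω | ∀ x ∈ Sr ω ((R : ℝ)/10) ∩ ballZ (0 : Pt d) R,
       ∀ y ∈ Sr ω ((R : ℝ)/10) ∩ ballZ (0 : Pt d) R,
       connIn (SS ω ∩ ballZ (0 : Pt d) (2*R)) x y}

/-- The axioms **P1**–**P3** and **S1**–**S2** of Drewitz–Ráth–Sapozhnikov for a
one-parameter family of probability measures on `{0,1}^{ℤ^d}`. -/
structure Axioms (d : ℕ) (a b : ℝ) (P : ℝ → Measure (Config d)) where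
  /-- decoupling exponent -/
  εP : ℝ
  /-- sprinkling exponent -/
  χP : ℝ
  RP : ℕ
  LP : ℕ
  fP : ℕ → ℝ
  fS : ℝ → ℕ → ℝ
  ΔS : ℝ → ℝ
  RS : ℝ → ℕ
  prob : ∀ u ∈ Set.Ioo a b, IsProbabilityMeasure (P u)
  /-- P1: every lattice shift is measure preserving and ergodic. -/
  ergodic : ∀ u ∈ Set.Ioo a b, ∀ x : Pt d, x ≠ 0 → Ergodic (shift x) (P u)
  /-- P2: monotonicity. -/
  mono : ∀ u ∈ Set.Ioo a b, ∀ u' ∈ Set.Ioo a b, u ≤ u' →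
    ∀ G : Set (Config d), MeasurableSet G → IncreasingEvent G → P u G ≤ P u' G
  εP_pos : 0 < εP
  χP_pos : 0 < χP
  fP_lb : ∀ L : ℕ, LP ≤ L → Real.exp ((Real.log L) ^ εP) ≤ fP L
  /-- P3, decoupling for decreasing events. -/
  decoupleDec : ∀ (R L : ℕ), RP ≤ R → 1 ≤ L → ∀ x₁ x₂ : Pt d, R * L ≤ distInf x₁ x₂ →
    ∀ u uh : ℝ, uh ∈ Set.Ioo a b → u ∈ Set.Ioo a b → uh < u →
    (1 + (R : ℝ) ^ (-χP)) * uh ≤ u →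
    ∀ A₁ A₂ : Set (Config d), MeasurableSet A₁ → MeasurableSet A₂ →
      DecreasingEvent A₁ → DecreasingEvent A₂ →
      DependsOn A₁ (ballZ x₁ (10*L)) → DependsOn A₂ (ballZ x₂ (10*L)) →
      (P u (A₁ ∩ A₂)).toReal ≤ (P uh A₁).toReal * (P uh A₂).toReal + Real.exp (-(fP L))
  /-- P3, decoupling for increasing events. -/
  decoupleInc : ∀ (R L : ℕ), RP ≤ R → 1 ≤ L → ∀ x₁ x₂ : Pt d, R * L ≤ distInf x₁ x₂ →
    ∀ u uh : ℝ, uh ∈ Set.Ioo a b → u ∈ Set.Ioo a b → uh < u →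
    (1 + (R : ℝ) ^ (-χP)) * uh ≤ u →
    ∀ B₁ B₂ : Set (Config d), MeasurableSet B₁ → MeasurableSet B₂ →
      IncreasingEvent B₁ → IncreasingEvent B₂ →
      DependsOn B₁ (ballZ x₁ (10*L)) → DependsOn B₂ (ballZ x₂ (10*L)) →
      (P uh (B₁ ∩ B₂)).toReal ≤ (P u B₁).toReal * (P u B₂).toReal + Real.exp (-(fP L))
  ΔS_pos : ∀ u ∈ Set.Ioo a b, 0 < ΔS u
  fS_lb : ∀ u ∈ Set.Ioo a b, ∀ R : ℕ, RS u ≤ R → (Real.log R) ^ (1 + ΔS u) ≤ fS u R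
  /-- S1, first part. -/
  S1a : ∀ u ∈ Set.Ioo a b, ∀ R : ℕ, 1 ≤ R →
    1 - Real.exp (-(fS u R)) ≤ (P u (locUniq1 d R)).toReal
  /-- S1, second part. -/
  S1b : ∀ u ∈ Set.Ioo a b, ∀ R : ℕ, 1 ≤ R →
    1 - Real.exp (-(fS u R)) ≤ (P u (locUniq2 d R)).toReal
  /-- S2: positivity of the density of the infinite cluster. -/
  S2pos : ∀ u ∈ Set.Ioo a b, 0 < eta d (P u)
  /-- S2: continuity of the density of the infinite cluster. -/
  S2cont : ContinuousOn (fun u => eta d (P u)) (Set.Ioo a b)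


/-! ### Renormalization scales and good/bad boxes -/

/-- The scales `l_k = l_0·4^{k^{θ_sc}}`. -/
def lSc (l0 θsc k : ℕ) : ℕ := l0 * 4 ^ (k ^ θsc)

/-- The scales `r_k = r_0·2^{k^{θ_sc}}`. -/
def rSc (r0 θsc k : ℕ) : ℕ := r0 * 2 ^ (k ^ θsc)

/-- The scales `L_0 = L_0`, `L_{k+1} = l_k·L_k`. -/
def LSc (l0 L0 θsc : ℕ) : ℕ → ℕ
  | 0 => L0
  | k+1 => lSc l0 θsc k * LSc l0 L0 θsc k

/-- The renormalized lattice `G = L·ℤ^d`. -/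
def lattice (d L : ℕ) : Set (Pt d) := {x | ∀ i, (L : ℤ) ∣ x i}

/-- The box `x + [0,n)^d`. -/
def box (x : Pt d) (n : ℕ) : Set (Pt d) := {y | ∀ i, x i ≤ y i ∧ y i < x i + n}

/-- The box `x + [lo,hi)^d`. -/
def boxI (x : Pt d) (lo hi : ℤ) : Set (Pt d) := {y | ∀ i, x i + lo ≤ y i ∧ y i < x i + hi}

/-- The corner `x + e·L_0` of the sub-box indexed by `e ∈ {0,1}^d`. -/
def subCorner (x : Pt d) (L0 : ℕ) (e : Fin d → Bool) : Pt d :=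
  fun i => x i + (if e i then (L0 : ℤ) else 0)

/-- `C` is a connected component of `S_{L0} ∩ B` of cardinality at least `(3/4)·η·L_0^d`. -/
def bigCompIn (ω : Config d) (η : ℝ) (L0 : ℕ) (B : Set (Pt d)) (C : Set (Pt d)) : Prop :=
  (∃ w ∈ Sr ω (L0 : ℝ) ∩ B, C = cluster (Sr ω (L0 : ℝ) ∩ B) w) ∧
  (3/4 : ℝ) * η * (L0 : ℝ) ^ d ≤ C.ncard

/-- The event `A^u_x`: each of the `2^d` sub-boxes of side `L_0` of `x + [0,2L_0)^d` contains a
connected component of `S_{L_0}` with at least `(3/4)·η·L_0^d` vertices, and all these components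
are connected in `S ∩ (x+[0,2L_0)^d)`. -/
def eventA (d : ℕ) (η : ℝ) (L0 : ℕ) (x : Pt d) : Set (Config d) :=
  {ω | (∀ e : Fin d → Bool, ∃ C, bigCompIn ω η L0 (box (subCorner x L0 e) L0) C) ∧
       (∀ e e' : Fin d → Bool, ∀ C C' : Set (Pt d), ∀ y z : Pt d,
          bigCompIn ω η L0 (box (subCorner x L0 e) L0) C →
          bigCompIn ω η L0 (box (subCorner x L0 e') L0) C' →
          y ∈ C → z ∈ C' → connIn (SS ω ∩ box x (2*L0)) y z)}

/-- The event `B^u_x`: each of the `2^d` sub-boxes of side `L_0` of `x + [0,2L_0)^d` contains at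
most `(5/4)·η·L_0^d` vertices of `S_{L_0}`. -/
def eventB (d : ℕ) (η : ℝ) (L0 : ℕ) (x : Pt d) : Set (Config d) :=
  {ω | ∀ e : Fin d → Bool,
    ((Sr ω (L0 : ℝ) ∩ box (subCorner x L0 e) L0).ncard : ℝ) ≤ (5/4 : ℝ) * η * (L0 : ℝ) ^ d}

/-- The recursive cascading of a family of "bad" seed events along the renormalization scheme. -/
def cascade (d : ℕ) (r0 l0 L0 θsc : ℕ) (seed : Pt d → Set (Config d)) :
    ℕ → Pt d → Set (Config d)
  | 0, x => seed x
  | k+1, x => {ω | ∃ x₁ x₂ : Pt d,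
      x₁ ∈ lattice d (LSc l0 L0 θsc k) ∩ box x (LSc l0 L0 θsc (k+1)) ∧
      x₂ ∈ lattice d (LSc l0 L0 θsc k) ∩ box x (LSc l0 L0 θsc (k+1)) ∧
      rSc r0 θsc k * LSc l0 L0 θsc k ≤ distInf x₁ x₂ ∧
      ω ∈ cascade d r0 l0 L0 θsc seed k x₁ ∧ ω ∈ cascade d r0 l0 L0 θsc seed k x₂}

/-- The event `Ā^u_{x,k}`. -/
def Abar (d : ℕ) (η : ℝ) (r0 l0 L0 θsc : ℕ) : ℕ → Pt d → Set (Config d) :=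
  cascade d r0 l0 L0 θsc (fun x => (eventA d η L0 x)ᶜ)

/-- The event `B̄^u_{x,k}`. -/
def Bbar (d : ℕ) (η : ℝ) (r0 l0 L0 θsc : ℕ) : ℕ → Pt d → Set (Config d) :=
  cascade d r0 l0 L0 θsc (fun x => (eventB d η L0 x)ᶜ)

/-- The event that `x ∈ G_k` is `k`-bad. -/
def kBad (d : ℕ) (η : ℝ) (r0 l0 L0 θsc k : ℕ) (x : Pt d) : Set (Config d) :=
  Abar d η r0 l0 L0 θsc k x ∪ Bbar d η r0 l0 L0 θsc k x

/-- The `i`-th coordinate unit vector of `ℤ^d`. -/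
def unitVec (i : Fin d) : Pt d := Pi.single i 1

/-- The segment `I_{x,i} = (x + (⌊L_0/2⌋,…,⌊L_0/2⌋) + ℤ·e_i) ∩ (x + [⌊L_0/3⌋,⌊2L_0/3⌋)^d)`. -/
def segmentI (x : Pt d) (L0 : ℕ) (i : Fin d) : Set (Pt d) :=
  {y | (∃ c : ℤ, y = (fun j => x j + (L0/2 : ℕ)) + c • unitVec i) ∧
       y ∈ boxI x ((L0/3 : ℕ) : ℤ) ((2*L0/3 : ℕ) : ℤ)}

/-- The modified event `𝒜^u_x`: the event `A^u_x` together with the axis-crossing condition (c):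
for each `1 ≤ i ≤ d`, the special connected component of `S_{L_0}` in `x+[0,L_0)^d` meets
`I_{x,i}`. -/
def eventAMod (d : ℕ) (η : ℝ) (L0 : ℕ) (x : Pt d) : Set (Config d) :=
  eventA d η L0 x ∩
  {ω | ∀ i : Fin d, ∀ C : Set (Pt d),
    bigCompIn ω η L0 (box x L0) C → (C ∩ segmentI x L0 i).Nonempty}

/-- The event `𝒜̄^u_{x,k}` of the modified renormalization. -/
def AbarMod (d : ℕ) (η : ℝ) (r0 l0 L0 θsc : ℕ) : ℕ → Pt d → Set (Config d) :=
  cascade d r0 l0 L0 θsc (fun x => (eventAMod d η L0 x)ᶜ)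

/-- The event that `x ∈ G_k` is `k`-bad for the modified renormalization. -/
def kBadMod (d : ℕ) (η : ℝ) (r0 l0 L0 θsc k : ℕ) (x : Pt d) : Set (Config d) :=
  AbarMod d η r0 l0 L0 θsc k x ∪ Bbar d η r0 l0 L0 θsc k x

/-! ### Basic geometry -/

lemma distInf_le_iff {x y : Pt d} {R : ℕ} :
    distInf x y ≤ R ↔ ∀ i, (x i - y i).natAbs ≤ R := by
  simp [distInf]

lemma natAbs_le_distInf (x y : Pt d) (i : Fin d) : (x i - y i).natAbs ≤ distInf x y :=
  distInf_le_iff.1 le_rfl i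

lemma mem_ballZ {x y : Pt d} {R : ℕ} : y ∈ ballZ x R ↔ ∀ i, (x i - y i).natAbs ≤ R :=
  distInf_le_iff

lemma distInf_le_dist1 (x y : Pt d) : distInf x y ≤ dist1 x y := by
  rw [distInf_le_iff]
  intro i
  exact Finset.single_le_sum (f := fun i => (x i - y i).natAbs) (fun _ _ => Nat.zero_le _)
    (Finset.mem_univ i)

lemma dist1_triangle (x y z : Pt d) : dist1 x z ≤ dist1 x y + dist1 y z := by
  unfold dist1
  rw [← Finset.sum_add_distrib]
  apply Finset.sum_le_sum
  intro i _
  omega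

lemma dist1_comm (x y : Pt d) : dist1 x y = dist1 y x := by
  unfold dist1
  apply Finset.sum_congr rfl
  intro i _
  omega

lemma dist1_self (x : Pt d) : dist1 x x = 0 := by simp [dist1]

lemma dist1_le_mul_distInf (x y : Pt d) : dist1 x y ≤ d * distInf x y := by
  unfold dist1
  calc _ ≤ ∑ _i : Fin d, distInf x y :=
        Finset.sum_le_sum (fun i _ => natAbs_le_distInf x y i)
    _ = _ := by simp

lemma ballZ_finite (x : Pt d) (R : ℕ) : (ballZ x R).Finite := by
  apply (Set.finite_Icc (fun i => x i - R) (fun i => x i + R)).subset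
  intro y hy
  rw [mem_ballZ] at hy
  constructor <;> intro i <;> have := hy i <;> simp only <;> omega

lemma box_finite (x : Pt d) (n : ℕ) : (box x n).Finite := by
  apply (Set.finite_Icc (fun i => x i) (fun i => x i + n)).subset
  intro y hy
  constructor <;> intro i <;> have := hy i <;> simp only <;> omega

lemma adj_symm {x y : Pt d} (h : adj x y) : adj y x := by
  unfold adj at *; rwa [dist1_comm]

lemma stepRel_symm {T : Set (Pt d)} {x y : Pt d} (h : stepRel T x y) : stepRel T y x :=
  ⟨adj_symm h.1, h.2.2, h.2.1⟩

lemma rtg_symm {T : Set (Pt d)} {x y : Pt d} (h : Relation.ReflTransGen (stepRel T) x y) :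
    Relation.ReflTransGen (stepRel T) y x := by
  induction h with
  | refl => exact .refl
  | tail _ h2 ih => exact (Relation.ReflTransGen.single (stepRel_symm h2)).trans ih

lemma connIn.symm {T : Set (Pt d)} {x y : Pt d} (h : connIn T x y) : connIn T y x :=
  ⟨h.2.1, h.1, rtg_symm h.2.2⟩

lemma connIn.trans {T : Set (Pt d)} {x y z : Pt d} (h : connIn T x y) (h' : connIn T y z) :
    connIn T x z :=
  ⟨h.1, h'.2.1, h.2.2.trans h'.2.2⟩

lemma connIn.refl {T : Set (Pt d)} {x : Pt d} (h : x ∈ T) : connIn T x x :=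
  ⟨h, h, .refl⟩

lemma connIn.mono {T T' : Set (Pt d)} (hT : T ⊆ T') {x y : Pt d} (h : connIn T x y) :
    connIn T' x y := by
  refine ⟨hT h.1, hT h.2.1, ?_⟩
  exact Relation.ReflTransGen.mono (r := stepRel T) (p := stepRel T')
    (fun a b hab => ⟨hab.1, hT hab.2.1, hT hab.2.2⟩) _ _ h.2.2

lemma cluster_mono {T T' : Set (Pt d)} (hT : T ⊆ T') (x : Pt d) :
    cluster T x ⊆ cluster T' x := fun _ h => connIn.mono hT h

lemma cluster_subset (T : Set (Pt d)) (x : Pt d) : cluster T x ⊆ T := fun _ h => h.2.1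

/-- along a connection inside `T`, if a set `U` is "closed" along it. -/
lemma connIn.inter {T U : Set (Pt d)} {x y : Pt d} (h : connIn T x y)
    (hU : ∀ z, connIn T x z → z ∈ U) : connIn (T ∩ U) x y := by
  obtain ⟨hx, hy, hp⟩ := h
  suffices H : Relation.ReflTransGen (stepRel (T ∩ U)) x y from
    ⟨⟨hx, hU _ (connIn.refl hx)⟩, ⟨hy, hU _ ⟨hx, hy, hp⟩⟩, H⟩
  clear hy
  induction hp with
  | refl => exact .refl
  | tail h1 h2 ih =>
    exact ih.tail ⟨h2.1, ⟨h2.2.1, hU _ ⟨hx, h2.2.1, h1⟩⟩,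
      ⟨h2.2.2, hU _ ⟨hx, h2.2.2, h1.tail h2⟩⟩⟩

lemma SS_mono {ω ω' : Config d} (h : ∀ x, ω x = true → ω' x = true) : SS ω ⊆ SS ω' :=
  fun x hx => h x hx

lemma Sr_subset_SS (ω : Config d) (r : ℝ) : Sr ω r ⊆ SS ω := fun _ h => h.1

lemma Sr_mono {ω ω' : Config d} (h : ∀ x, ω x = true → ω' x = true) (r : ℝ) :
    Sr ω r ⊆ Sr ω' r := by
  rintro x ⟨hx, y, hy, z, hz, hr⟩
  exact ⟨SS_mono h hx, y, cluster_mono (SS_mono h) x hy, z, cluster_mono (SS_mono h) x hz, hr⟩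

lemma Sr_anti (ω : Config d) {r r' : ℝ} (h : r ≤ r') : Sr ω r' ⊆ Sr ω r := by
  rintro x ⟨hx, y, hy, z, hz, hr⟩
  exact ⟨hx, y, hy, z, hz, h.trans hr⟩

lemma Sr_conn {ω : Config d} {r : ℝ} {x y : Pt d} (hx : x ∈ Sr ω r)
    (h : connIn (SS ω) x y) : y ∈ Sr ω r := by
  obtain ⟨hx, y', hy, z, hz, hr⟩ := hx
  exact ⟨h.2.1, y', connIn.trans h.symm hy, z, connIn.trans h.symm hz, hr⟩

lemma Sr_ceil (ω : Config d) (r : ℝ) : Sr ω r = Sr ω ((⌈r⌉₊ : ℕ) : ℝ) := by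
  unfold Sr
  simp only [Nat.cast_le, Nat.ceil_le]

/-- a connection in `S ∩ U` starting from a vertex of `S_r` is a connection in `S_r ∩ U`. -/
lemma connIn_Sr {ω : Config d} {r : ℝ} {U : Set (Pt d)} {x y : Pt d} (hx : x ∈ Sr ω r)
    (h : connIn (SS ω ∩ U) x y) : connIn (Sr ω r ∩ U) x y := by
  have := connIn.inter (U := Sr ω r) h
    (fun z hz => Sr_conn hx (connIn.mono Set.inter_subset_left hz))
  exact this.mono (T' := Sr ω r ∩ U) (fun z hz => ⟨hz.2, hz.1.2⟩)

/-! ### Shifts -/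

lemma dist1_add_left (v x y : Pt d) : dist1 (v + x) (v + y) = dist1 x y := by
  unfold dist1
  simp

lemma distInf_add_left (v x y : Pt d) : distInf (v + x) (v + y) = distInf x y := by
  unfold distInf
  simp

lemma connIn_image (v : Pt d) {T T' : Set (Pt d)} (hT : ∀ x, x ∈ T → v + x ∈ T')
    {x y : Pt d} (h : connIn T x y) : connIn T' (v + x) (v + y) := by
  refine ⟨hT _ h.1, hT _ h.2.1, ?_⟩
  refine Relation.ReflTransGen.lift (fun x => v + x) ?_ _ _ h.2.2
  intro a b hab
  exact ⟨by have := hab.1; unfold adj at *; rwa [dist1_add_left], hT _ hab.2.1, hT _ hab.2.2⟩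

lemma mem_SS_shift (v x : Pt d) (ω : Config d) : x ∈ SS (shift v ω) ↔ v + x ∈ SS ω := Iff.rfl

lemma shift_zero (ω : Config d) : shift 0 ω = ω := by
  funext y; simp [shift]

lemma shift_shift (v w : Pt d) (ω : Config d) : shift v (shift w ω) = shift (w + v) ω := by
  funext y; simp [shift, add_assoc]

lemma mem_Sr_shift_aux (v x : Pt d) (ω : Config d) (r : ℝ) (h : x ∈ Sr (shift v ω) r) :
    v + x ∈ Sr ω r := by
  obtain ⟨hx, y, hy, z, hz, hr⟩ := h
  refine ⟨hx, v + y, connIn_image v (fun _ h => h) hy, v + z,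
    connIn_image v (fun _ h => h) hz, ?_⟩
  rwa [dist1_add_left]

lemma mem_Sr_shift (v x : Pt d) (ω : Config d) (r : ℝ) :
    x ∈ Sr (shift v ω) r ↔ v + x ∈ Sr ω r := by
  refine ⟨mem_Sr_shift_aux v x ω r, fun h => ?_⟩
  have := mem_Sr_shift_aux (-v) (v + x) (shift v ω) r (by rwa [shift_shift, add_neg_cancel,
    shift_zero])
  simpa using this

/-! ### Infinite clusters -/

lemma mem_Sinf_iff (ω : Config d) (x : Pt d) : x ∈ Sinf ω ↔ ∀ M : ℕ, x ∈ Sr ω (M : ℝ) := by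
  constructor
  · rintro ⟨hx, hinf⟩ M
    by_contra hcon
    apply hinf
    apply (ballZ_finite x M).subset
    intro y hy
    by_contra hy'
    apply hcon
    refine ⟨hx, x, connIn.refl hx, y, hy, ?_⟩
    have h1 : ¬ distInf x y ≤ M := hy'
    have := distInf_le_dist1 x y
    exact_mod_cast (by omega : M ≤ dist1 x y)
  · intro h
    refine ⟨(h 0).1, fun hfin => ?_⟩
    obtain ⟨N, hN⟩ : ∃ N : ℕ, ∀ y ∈ cluster (SS ω) x, dist1 x y ≤ N := by
      obtain ⟨N, hN⟩ := (hfin.image (dist1 x)).bddAbove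
      exact ⟨N, fun y hy => hN ⟨y, hy, rfl⟩⟩
    obtain ⟨_, y, hy, z, hz, hr⟩ := h (2 * N + 1)
    have h1 := hN y hy
    have h2 := hN z hz
    have h3 := dist1_triangle y x z
    rw [dist1_comm y x] at h3
    have : 2 * N + 1 ≤ dist1 y z := by exact_mod_cast hr
    omega

lemma mem_Sinf_shift (v x : Pt d) (ω : Config d) :
    x ∈ Sinf (shift v ω) ↔ v + x ∈ Sinf ω := by
  simp only [mem_Sinf_iff, mem_Sr_shift]

/-! ### Locality -/

lemma local_aux {ω : Config d} {r : ℕ} {x y : Pt d} (h : connIn (SS ω) x y) :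
    connIn (SS ω ∩ ballZ x r) x y ∨
      ∃ y', connIn (SS ω ∩ ballZ x r) x y' ∧ r ≤ dist1 x y' := by
  obtain ⟨hx, hy, hp⟩ := h
  have hxx : x ∈ SS ω ∩ ballZ x r := ⟨hx, by rw [mem_ballZ]; simp⟩
  clear hy
  induction hp with
  | refl => exact Or.inl (connIn.refl hxx)
  | tail h1 h2 ih =>
    rename_i y w
    rcases ih with ih | ih
    · by_cases hd : r ≤ dist1 x y
      · exact Or.inr ⟨y, ih, hd⟩
      · left
        have hw : w ∈ ballZ x r := by
          change distInf x w ≤ r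
          have := distInf_le_dist1 x w
          have := dist1_triangle x y w
          have h3 : dist1 y w = 1 := h2.1
          omega
        have hw' : w ∈ SS ω ∩ ballZ x r := ⟨h2.2.2, hw⟩
        exact ih.trans ⟨ih.2.1, hw', Relation.ReflTransGen.single ⟨h2.1, ih.2.1, hw'⟩⟩
    · exact Or.inr ih

lemma mem_Sr_local (ω : Config d) (r : ℕ) (x : Pt d) :
    x ∈ Sr ω (r : ℝ) ↔ x ∈ SS ω ∧ ∃ y ∈ cluster (SS ω ∩ ballZ x r) x,
      ∃ z ∈ cluster (SS ω ∩ ballZ x r) x, r ≤ dist1 y z := by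
  constructor
  · rintro ⟨hx, y, hy, z, hz, hr⟩
    refine ⟨hx, ?_⟩
    have hxx : x ∈ SS ω ∩ ballZ x r := ⟨hx, by rw [mem_ballZ]; simp⟩
    rcases local_aux (r := r) hy with h1 | ⟨y', h1, h1'⟩
    · rcases local_aux (r := r) hz with h2 | ⟨y', h2, h2'⟩
      · exact ⟨y, h1, z, h2, by exact_mod_cast hr⟩
      · exact ⟨x, connIn.refl hxx, y', h2, h2'⟩
    · exact ⟨x, connIn.refl hxx, y', h1, h1'⟩
  · rintro ⟨hx, y, hy, z, hz, hr⟩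
    exact ⟨hx, y, hy.mono Set.inter_subset_left, z, hz.mono Set.inter_subset_left,
      by exact_mod_cast hr⟩

lemma SS_inter_congr {ω ω' : Config d} {B : Set (Pt d)} (h : ∀ x ∈ B, ω x = ω' x) :
    SS ω ∩ B = SS ω' ∩ B := by
  ext x
  constructor
  · rintro ⟨h1, h2⟩
    refine ⟨?_, h2⟩
    have h1 : ω x = true := h1
    change ω' x = true
    rw [← h x h2, h1]
  · rintro ⟨h1, h2⟩
    refine ⟨?_, h2⟩
    have h1 : ω' x = true := h1
    change ω x = true
    rw [h x h2, h1]

lemma mem_ballZ_self (x : Pt d) (r : ℕ) : x ∈ ballZ x r := by rw [mem_ballZ]; simp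

lemma mem_Sr_congr {ω ω' : Config d} {r : ℕ} {x : Pt d}
    (h : ∀ y ∈ ballZ x r, ω y = ω' y) : x ∈ Sr ω (r : ℝ) ↔ x ∈ Sr ω' (r : ℝ) := by
  rw [mem_Sr_local, mem_Sr_local, SS_inter_congr h]
  have : x ∈ SS ω ↔ x ∈ SS ω' := by
    change ω x = true ↔ ω' x = true
    rw [h x (mem_ballZ_self x r)]
  rw [this]

lemma Sr_inter_congr {ω ω' : Config d} {r : ℕ} {B B' : Set (Pt d)}
    (hB : ∀ x ∈ B, ballZ x r ⊆ B') (h : ∀ y ∈ B', ω y = ω' y) :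
    Sr ω (r : ℝ) ∩ B = Sr ω' (r : ℝ) ∩ B := by
  ext x
  constructor
  · rintro ⟨h1, h2⟩
    exact ⟨(mem_Sr_congr (fun y hy => h y (hB x h2 hy))).1 h1, h2⟩
  · rintro ⟨h1, h2⟩
    exact ⟨(mem_Sr_congr (fun y hy => h y (hB x h2 hy))).2 h1, h2⟩

lemma ballZ_subset {x y : Pt d} {r s : ℕ} (h : distInf x y + r ≤ s) :
    ballZ y r ⊆ ballZ x s := by
  intro z hz
  rw [mem_ballZ] at *
  intro i
  have h1 := hz i
  have h2 := natAbs_le_distInf x y i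
  omega

lemma DependsOn.mono {G : Set (Config d)} {B B' : Set (Pt d)} (h : DependsOn G B)
    (hB : B ⊆ B') : DependsOn G B' :=
  fun ω ω' hω => h ω ω' (fun x hx => hω x (hB hx))

lemma DependsOn.compl {G : Set (Config d)} {B : Set (Pt d)} (h : DependsOn G B) :
    DependsOn Gᶜ B :=
  fun ω ω' hω => not_congr (h ω ω' hω)

lemma DependsOn.measurableSet {G : Set (Config d)} {B : Set (Pt d)} (h : DependsOn G B)
    (hB : B.Finite) : MeasurableSet G := by
  have : Finite B := hB
  let f : Config d → (B → Bool) := fun ω x => ω x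
  have hf : Measurable f := by
    apply measurable_pi_lambda
    intro x
    exact measurable_pi_apply _
  have hG : G = f ⁻¹' (f '' G) := by
    apply Set.Subset.antisymm (Set.subset_preimage_image f G)
    rintro ω ⟨ω', hω', he⟩
    exact (h ω' ω (fun x hx => congrFun he ⟨x, hx⟩)).1 hω'
  rw [hG]
  exact hf (Set.toFinite _).measurableSet

lemma measurable_shift (v : Pt d) : Measurable (shift v) := by
  apply measurable_pi_lambda
  intro x
  exact measurable_pi_apply _

lemma dependsOn_mem_Sr (x : Pt d) (r : ℕ) :
    DependsOn {ω : Config d | x ∈ Sr ω (r : ℝ)} (ballZ x r) :=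
  fun _ _ h => mem_Sr_congr h

lemma measurableSet_mem_Sr (x : Pt d) (r : ℕ) :
    MeasurableSet {ω : Config d | x ∈ Sr ω (r : ℝ)} :=
  (dependsOn_mem_Sr x r).measurableSet (ballZ_finite x r)

lemma measurableSet_mem_Sinf (x : Pt d) : MeasurableSet {ω : Config d | x ∈ Sinf ω} := by
  have : {ω : Config d | x ∈ Sinf ω} = ⋂ M : ℕ, {ω : Config d | x ∈ Sr ω (M : ℝ)} := by
    ext ω; simp [mem_Sinf_iff]
  rw [this]
  exact MeasurableSet.iInter (fun M => measurableSet_mem_Sr x M)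

lemma measurableSet_locUniq1 (R : ℕ) : MeasurableSet (locUniq1 d R) := by
  apply DependsOn.measurableSet (B := ballZ 0 (R + R)) _ (ballZ_finite _ _)
  intro ω ω' h
  have : Sr ω (R : ℝ) ∩ ballZ 0 R = Sr ω' (R : ℝ) ∩ ballZ 0 R := by
    apply Sr_inter_congr _ h
    intro x hx
    apply ballZ_subset
    have : distInf 0 x ≤ R := hx
    omega
  change (Sr ω (R : ℝ) ∩ ballZ 0 R).Nonempty ↔ (Sr ω' (R : ℝ) ∩ ballZ 0 R).Nonempty
  rw [this]

lemma measurableSet_locUniq2 (R : ℕ) : MeasurableSet (locUniq2 d R) := by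
  apply DependsOn.measurableSet (B := ballZ 0 (2 * R + ⌈(R : ℝ) / 10⌉₊)) _ (ballZ_finite _ _)
  intro ω ω' h
  have h1 : Sr ω ((R : ℝ) / 10) ∩ ballZ 0 R = Sr ω' ((R : ℝ) / 10) ∩ ballZ 0 R := by
    rw [Sr_ceil ω, Sr_ceil ω']
    apply Sr_inter_congr _ h
    intro x hx
    apply ballZ_subset
    have : distInf 0 x ≤ R := hx
    omega
  have h2 : SS ω ∩ ballZ 0 (2 * R) = SS ω' ∩ ballZ 0 (2 * R) := by
    apply SS_inter_congr
    intro x hx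
    apply h
    rw [mem_ballZ] at *
    intro i
    have := hx i
    omega
  simp only [locUniq2, Set.mem_ofPred_eq, h1, h2]

/-! ### The multiscale estimate -/

/-- `G` is closed under `rel`. -/
def UpSet (rel : Config d → Config d → Prop) (G : Set (Config d)) : Prop :=
  ∀ ω ω' : Config d, rel ω ω' → ω ∈ G → ω' ∈ G

/-- There is a cascade at scale `k` rooted at `x`, with exactly `m` selected leaves, all of which
are in the seed event. -/
def EE (d : ℕ) (r0 l0 L0 θsc : ℕ) (seed : Pt d → Set (Config d)) :
    ℕ → Pt d → ℕ → Set (Config d)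
  | 0, x, m => {ω | m = 0 ∨ (m = 1 ∧ ω ∈ seed x)}
  | k+1, x, m => {ω | ∃ x₁ x₂ : Pt d, ∃ m₁ m₂ : ℕ, m₁ + m₂ = m ∧
      x₁ ∈ lattice d (LSc l0 L0 θsc k) ∩ box x (LSc l0 L0 θsc (k+1)) ∧
      x₂ ∈ lattice d (LSc l0 L0 θsc k) ∩ box x (LSc l0 L0 θsc (k+1)) ∧
      rSc r0 θsc k * LSc l0 L0 θsc k ≤ distInf x₁ x₂ ∧
      ω ∈ EE d r0 l0 L0 θsc seed k x₁ m₁ ∧ ω ∈ EE d r0 l0 L0 θsc seed k x₂ m₂}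

lemma cascade_mono {r0 l0 L0 θ : ℕ} {s s' : Pt d → Set (Config d)} (h : ∀ x, s x ⊆ s' x) :
    ∀ k x, cascade d r0 l0 L0 θ s k x ⊆ cascade d r0 l0 L0 θ s' k x := by
  intro k
  induction k with
  | zero => intro x; exact h x
  | succ k ih =>
    rintro x ω ⟨x₁, x₂, h1, h2, h3, h4, h5⟩
    exact ⟨x₁, x₂, h1, h2, h3, ih _ h4, ih _ h5⟩

lemma cascade_union_subset {r0 l0 L0 θ : ℕ} {s s' : Pt d → Set (Config d)} :
    ∀ k x ω, ω ∈ cascade d r0 l0 L0 θ (fun x => s x ∪ s' x) k x →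
      ∃ m m', m + m' = 2 ^ k ∧ ω ∈ EE d r0 l0 L0 θ s k x m ∧ ω ∈ EE d r0 l0 L0 θ s' k x m' := by
  intro k
  induction k with
  | zero =>
    intro x ω hω
    rcases hω with hω | hω
    · exact ⟨1, 0, rfl, Or.inr ⟨rfl, hω⟩, Or.inl rfl⟩
    · exact ⟨0, 1, rfl, Or.inl rfl, Or.inr ⟨rfl, hω⟩⟩
  | succ k ih =>
    rintro x ω ⟨x₁, x₂, h1, h2, h3, h4, h5⟩
    obtain ⟨a, a', ha, ha1, ha2⟩ := ih _ _ h4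
    obtain ⟨b, b', hb, hb1, hb2⟩ := ih _ _ h5
    refine ⟨a + b, a' + b', by rw [pow_succ]; omega,
      ⟨x₁, x₂, a, b, rfl, h1, h2, h3, ha1, hb1⟩, ⟨x₁, x₂, a', b', rfl, h1, h2, h3, ha2, hb2⟩⟩

lemma EE_le {r0 l0 L0 θ : ℕ} {s : Pt d → Set (Config d)} :
    ∀ k x m ω, ω ∈ EE d r0 l0 L0 θ s k x m → m ≤ 2 ^ k := by
  intro k
  induction k with
  | zero =>
    intro x m ω hω
    rcases hω with rfl | ⟨rfl, _⟩ <;> simp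
  | succ k ih =>
    rintro x m ω ⟨x₁, x₂, m₁, m₂, rfl, h1, h2, h3, h4, h5⟩
    have := ih _ _ _ h4
    have := ih _ _ _ h5
    rw [pow_succ]; omega

lemma EE_up {r0 l0 L0 θ : ℕ} {s : Pt d → Set (Config d)} {rel : Config d → Config d → Prop}
    (hs : ∀ x, UpSet rel (s x)) :
    ∀ k x m, UpSet rel (EE d r0 l0 L0 θ s k x m) := by
  intro k
  induction k with
  | zero =>
    rintro x m ω ω' hr (h | ⟨h, h'⟩)
    · exact Or.inl h
    · exact Or.inr ⟨h, hs x _ _ hr h'⟩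
  | succ k ih =>
    rintro x m ω ω' hr ⟨x₁, x₂, m₁, m₂, h0, h1, h2, h3, h4, h5⟩
    exact ⟨x₁, x₂, m₁, m₂, h0, h1, h2, h3, ih _ _ _ _ hr h4, ih _ _ _ _ hr h5⟩

lemma lSc_ge {l0 : ℕ} (θ k : ℕ) : l0 ≤ lSc l0 θ k :=
  Nat.le_mul_of_pos_right _ (by positivity)

lemma LSc_ge {l0 L0 : ℕ} (hl : 1 ≤ l0) (θ k : ℕ) : L0 ≤ LSc l0 L0 θ k := by
  induction k with
  | zero => exact le_rfl
  | succ k ih =>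
    have h1 : 1 ≤ lSc l0 θ k := hl.trans (lSc_ge θ k)
    calc L0 ≤ LSc l0 L0 θ k := ih
      _ ≤ lSc l0 θ k * LSc l0 L0 θ k := Nat.le_mul_of_pos_left _ h1

lemma EE_dep {r0 l0 L0 θ : ℕ} {s : Pt d → Set (Config d)} (hl : 2 ≤ l0)
    (hs : ∀ x, DependsOn (s x) (ballZ x (3 * L0))) :
    ∀ k x m, DependsOn (EE d r0 l0 L0 θ s k x m) (ballZ x (3 * L0 + 2 * LSc l0 L0 θ k)) := by
  intro k
  induction k with
  | zero =>
    intro x m ω ω' h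
    have := hs x ω ω' (fun y hy => h y (ballZ_subset (x := x) (y := x) (by
      have : distInf x x = 0 := by simp [distInf]
      omega) hy))
    change (m = 0 ∨ (m = 1 ∧ ω ∈ s x)) ↔ (m = 0 ∨ (m = 1 ∧ ω' ∈ s x))
    rw [this]
  | succ k ih =>
    have hL : 2 * LSc l0 L0 θ k ≤ LSc l0 L0 θ (k + 1) :=
      Nat.mul_le_mul_right _ (hl.trans (lSc_ge θ k))
    have key : ∀ x x₁ : Pt d, x₁ ∈ box x (LSc l0 L0 θ (k + 1)) →
        ballZ x₁ (3 * L0 + 2 * LSc l0 L0 θ k) ⊆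
          ballZ x (3 * L0 + 2 * LSc l0 L0 θ (k + 1)) := by
      intro x x₁ hx
      apply ballZ_subset
      have : distInf x x₁ ≤ LSc l0 L0 θ (k + 1) := by
        rw [distInf_le_iff]
        intro i
        have := hx i
        omega
      omega
    have half : ∀ x m ω ω', (∀ y ∈ ballZ x (3 * L0 + 2 * LSc l0 L0 θ (k + 1)), ω y = ω' y) →
        ω ∈ EE d r0 l0 L0 θ s (k + 1) x m → ω' ∈ EE d r0 l0 L0 θ s (k + 1) x m := by
      rintro x m ω ω' h ⟨x₁, x₂, m₁, m₂, h0, h1, h2, h3, h4, h5⟩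
      refine ⟨x₁, x₂, m₁, m₂, h0, h1, h2, h3, ?_, ?_⟩
      · exact (ih x₁ m₁ ω ω' (fun y hy => h y (key x x₁ h1.2 hy))).1 h4
      · exact (ih x₂ m₂ ω ω' (fun y hy => h y (key x x₂ h2.2 hy))).1 h5
    intro x m ω ω' h
    exact ⟨half x m ω ω' h, half x m ω' ω (fun y hy => (h y hy).symm)⟩

lemma EE_dep' {r0 l0 L0 θ : ℕ} {s : Pt d → Set (Config d)} (hl : 2 ≤ l0)
    (hs : ∀ x, DependsOn (s x) (ballZ x (3 * L0))) (k : ℕ) (x : Pt d) (m : ℕ) :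
    DependsOn (EE d r0 l0 L0 θ s k x m) (ballZ x (10 * LSc l0 L0 θ k)) := by
  apply (EE_dep hl hs k x m).mono
  apply ballZ_subset
  have : distInf x x = 0 := by simp [distInf]
  have := LSc_ge (L0 := L0) (l0 := l0) (by omega) θ k
  omega

lemma EE_meas {r0 l0 L0 θ : ℕ} {s : Pt d → Set (Config d)} (hl : 2 ≤ l0)
    (hs : ∀ x, DependsOn (s x) (ballZ x (3 * L0))) (k : ℕ) (x : Pt d) (m : ℕ) :
    MeasurableSet (EE d r0 l0 L0 θ s k x m) :=
  (EE_dep' hl hs k x m).measurableSet (ballZ_finite _ _)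

/-- The lattice points of spacing `L` in a box of side `l * L`. -/
lemma exists_latticeFinset (x : Pt d) (l L : ℕ) (hL : 1 ≤ L) :
    ∃ Q : Finset (Pt d), (∀ y, y ∈ lattice d L ∩ box x (l * L) → y ∈ Q) ∧ Q.card ≤ l ^ d := by
  classical
  refine ⟨Fintype.piFinset
    (fun i => (Finset.Ico (x i) (x i + ((l * L : ℕ) : ℤ))).filter (fun z => (L : ℤ) ∣ z)), ?_, ?_⟩
  · rintro y ⟨h1, h2⟩
    rw [Fintype.mem_piFinset]
    intro i
    rw [Finset.mem_filter, Finset.mem_Ico]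
    exact ⟨h2 i, h1 i⟩
  · rw [Fintype.card_piFinset]
    calc _ ≤ ∏ _i : Fin d, l := by
          apply Finset.prod_le_prod' 
          intro i _
          have hL' : (0 : ℤ) < L := by exact_mod_cast hL
          have := Int.Ico_filter_dvd_card (x i) (x i + ((l * L : ℕ) : ℤ)) hL'
          have h3 : (((Finset.Ico (x i) (x i + ((l * L : ℕ) : ℤ))).filter
            (fun z => (L : ℤ) ∣ z)).card : ℤ) ≤ l := by
            rw [this]
            have hL2 : ((L : ℤ) : ℚ) ≠ 0 := by exact_mod_cast hL'.ne'
            have : ((x i + ((l * L : ℕ) : ℤ) : ℤ) : ℚ) / ((L : ℤ) : ℚ)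
                = ((x i : ℤ) : ℚ) / ((L : ℤ) : ℚ) + (l : ℤ) := by
              push_cast
              push_cast at hL2
              field_simp
            rw [this, Int.ceil_add_intCast]
            simp
          exact_mod_cast h3
      _ = l ^ d := by simp

/-- The combinatorial constants. -/
noncomputable def cc (d l0 θ : ℕ) : ℕ → ℝ
  | 0 => 1
  | k+1 => 2 * (2 ^ (k + 1) + 1) * ((lSc l0 θ k : ℝ) ^ d) ^ 2 * (cc d l0 θ k) ^ 2

lemma cc_ge_one {l0 : ℕ} (hl : 1 ≤ l0) (θ k : ℕ) : 1 ≤ cc d l0 θ k := by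
  induction k with
  | zero => exact le_rfl
  | succ k ih =>
    have h1 : (1 : ℝ) ≤ lSc l0 θ k := by exact_mod_cast hl.trans (lSc_ge θ k)
    have h2 : (1 : ℝ) ≤ ((lSc l0 θ k : ℝ) ^ d) ^ 2 := one_le_pow₀ (one_le_pow₀ h1)
    have h3 : (1 : ℝ) ≤ (cc d l0 θ k) ^ 2 := one_le_pow₀ ih
    have h4 : (1 : ℝ) ≤ 2 * (2 ^ (k + 1) + 1) := by
      have : (0 : ℝ) ≤ 2 ^ (k + 1) := by positivity
      linarith
    change (1 : ℝ) ≤ 2 * (2 ^ (k + 1) + 1) * ((lSc l0 θ k : ℝ) ^ d) ^ 2 * (cc d l0 θ k) ^ 2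
    exact one_le_mul_of_one_le_of_one_le (one_le_mul_of_one_le_of_one_le h4 h2) h3

lemma EE_bound {r0 l0 L0 θ : ℕ} {s : Pt d → Set (Config d)} {rel : Config d → Config d → Prop}
    (hl : 2 ≤ l0) (hL0 : 1 ≤ L0)
    (hdep : ∀ x, DependsOn (s x) (ballZ x (3 * L0))) (hup : ∀ x, UpSet rel (s x))
    (μ : ℕ → Measure (Config d)) [hμ : ∀ k, IsProbabilityMeasure (μ k)] (err : ℕ → ℝ) (q : ℝ)
    (hq0 : 0 ≤ q) (hq1 : q ≤ 1)
    (hdec : ∀ k, ∀ x₁ x₂ : Pt d, rSc r0 θ k * LSc l0 L0 θ k ≤ distInf x₁ x₂ →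
      ∀ A₁ A₂ : Set (Config d), MeasurableSet A₁ → MeasurableSet A₂ → UpSet rel A₁ →
        UpSet rel A₂ → DependsOn A₁ (ballZ x₁ (10 * LSc l0 L0 θ k)) →
        DependsOn A₂ (ballZ x₂ (10 * LSc l0 L0 θ k)) →
        (μ (k + 1) (A₁ ∩ A₂)).toReal ≤ (μ k A₁).toReal * (μ k A₂).toReal + err k)
    (herr : ∀ k, err k ≤ q ^ (2 ^ (k + 1)))
    (hseed : ∀ x, (μ 0 (s x)).toReal ≤ q) :
    ∀ k x m, (μ k (EE d r0 l0 L0 θ s k x m)).toReal ≤ cc d l0 θ k * q ^ m := by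
  intro k
  induction k with
  | zero =>
    intro x m
    change (μ 0 {ω | m = 0 ∨ (m = 1 ∧ ω ∈ s x)}).toReal ≤ 1 * q ^ m
    rcases Nat.lt_trichotomy m 1 with h | rfl | h
    · obtain rfl : m = 0 := by omega
      simp
    · simpa using hseed x
    · have h0 : m ≠ 0 := by omega
      have h1 : m ≠ 1 := by omega
      simp only [h0, h1, false_and, or_false]
      simp
      positivity
  | succ k ih =>
    intro x m
    by_cases hm : m ≤ 2 ^ (k + 1)
    swap
    · have : EE d r0 l0 L0 θ s (k + 1) x m = ∅ := by
        ext ω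
        simp only [Set.mem_empty_iff_false, iff_false]
        exact fun h => hm (EE_le _ _ _ _ h)
      rw [this]
      have := cc_ge_one (d := d) (l0 := l0) (by omega) θ (k + 1)
      simp
      positivity
    have hLk : 1 ≤ LSc l0 L0 θ k := hL0.trans (LSc_ge (by omega) θ k)
    obtain ⟨Q, hQ, hQc⟩ := exists_latticeFinset x (lSc l0 θ k) (LSc l0 L0 θ k) hLk
    classical
    let J : Finset ((Pt d × Pt d) × (ℕ × ℕ)) :=
      ((Q ×ˢ Q).filter (fun p => rSc r0 θ k * LSc l0 L0 θ k ≤ distInf p.1 p.2)) ×ˢ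
        Finset.HasAntidiagonal.antidiagonal m
    have hsub : EE d r0 l0 L0 θ s (k + 1) x m ⊆ ⋃ j ∈ J,
        (EE d r0 l0 L0 θ s k j.1.1 j.2.1 ∩ EE d r0 l0 L0 θ s k j.1.2 j.2.2) := by
      rintro ω ⟨x₁, x₂, m₁, m₂, h0, h1, h2, h3, h4, h5⟩
      simp only [Set.mem_iUnion]
      refine ⟨((x₁, x₂), (m₁, m₂)), ?_, h4, h5⟩
      simp only [J, Finset.mem_product, Finset.mem_filter, Finset.HasAntidiagonal.mem_antidiagonal]
      exact ⟨⟨⟨hQ _ h1, hQ _ h2⟩, h3⟩, h0⟩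
    have hc1 := cc_ge_one (d := d) (l0 := l0) (by omega) θ k
    have hterm : ∀ j ∈ J, (μ (k + 1) (EE d r0 l0 L0 θ s k j.1.1 j.2.1 ∩
        EE d r0 l0 L0 θ s k j.1.2 j.2.2)).toReal ≤ 2 * (cc d l0 θ k) ^ 2 * q ^ m := by
      intro j hj
      simp only [J, Finset.mem_product, Finset.mem_filter, Finset.HasAntidiagonal.mem_antidiagonal] at hj
      have h1 := hdec k j.1.1 j.1.2 hj.1.2 _ _ (EE_meas (θ := θ) (r0 := r0) hl hdep k j.1.1 j.2.1)
        (EE_meas (θ := θ) (r0 := r0) hl hdep k j.1.2 j.2.2)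
        (EE_up hup k _ _) (EE_up hup k _ _) (EE_dep' hl hdep k _ _) (EE_dep' hl hdep k _ _)
      have h2 : err k ≤ q ^ m := (herr k).trans (pow_le_pow_of_le_one hq0 hq1 hm)
      have h3 : (μ k (EE d r0 l0 L0 θ s k j.1.1 j.2.1)).toReal *
          (μ k (EE d r0 l0 L0 θ s k j.1.2 j.2.2)).toReal ≤
          (cc d l0 θ k * q ^ j.2.1) * (cc d l0 θ k * q ^ j.2.2) :=
        mul_le_mul (ih _ _) (ih _ _) ENNReal.toReal_nonneg (by positivity)
      have h4 : (cc d l0 θ k * q ^ j.2.1) * (cc d l0 θ k * q ^ j.2.2)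
          = (cc d l0 θ k) ^ 2 * q ^ m := by
        rw [← hj.2, pow_add]; ring
      have h5 : q ^ m ≤ (cc d l0 θ k) ^ 2 * q ^ m :=
        le_mul_of_one_le_left (by positivity) (one_le_pow₀ hc1)
      linarith
    have hcard : (J.card : ℝ) ≤ ((lSc l0 θ k : ℝ) ^ d) ^ 2 * (2 ^ (k + 1) + 1) := by
      have h1 : J.card ≤ ((lSc l0 θ k) ^ d) ^ 2 * (2 ^ (k + 1) + 1) := by
        simp only [J, Finset.card_product, Finset.Nat.card_antidiagonal]
        apply Nat.mul_le_mul _ (by omega)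
        calc _ ≤ (Q ×ˢ Q).card := Finset.card_filter_le _ _
          _ = Q.card * Q.card := Finset.card_product _ _
          _ ≤ _ := by rw [pow_two]; exact Nat.mul_le_mul hQc hQc
      exact_mod_cast h1
    calc (μ (k + 1) (EE d r0 l0 L0 θ s (k + 1) x m)).toReal
        ≤ (μ (k + 1)).real (⋃ j ∈ J, (EE d r0 l0 L0 θ s k j.1.1 j.2.1 ∩
            EE d r0 l0 L0 θ s k j.1.2 j.2.2)) := measureReal_mono hsub (measure_ne_top _ _)
      _ ≤ ∑ j ∈ J, (μ (k + 1)).real (EE d r0 l0 L0 θ s k j.1.1 j.2.1 ∩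
            EE d r0 l0 L0 θ s k j.1.2 j.2.2) := measureReal_biUnion_finset_le _ _
      _ ≤ ∑ j ∈ J, 2 * (cc d l0 θ k) ^ 2 * q ^ m := Finset.sum_le_sum hterm
      _ = J.card * (2 * (cc d l0 θ k) ^ 2 * q ^ m) := by simp
      _ ≤ (((lSc l0 θ k : ℝ) ^ d) ^ 2 * (2 ^ (k + 1) + 1)) * (2 * (cc d l0 θ k) ^ 2 * q ^ m) :=
          mul_le_mul_of_nonneg_right hcard (by positivity)
      _ = 2 * (2 ^ (k + 1) + 1) * ((lSc l0 θ k : ℝ) ^ d) ^ 2 * (cc d l0 θ k) ^ 2 * q ^ m := by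
          ring

/-! ### Constants -/

lemma cc_bound (d l0 θ : ℕ) (hl : 1 ≤ l0) :
    ∃ K : ℝ, 1 ≤ K ∧ ∀ k, cc d l0 θ k ≤ K ^ (2 ^ k) := by
  let a : ℕ → ℝ := fun k => 2 * (2 ^ (k + 1) + 1) * ((lSc l0 θ k : ℝ) ^ d) ^ 2
  have ha1 : ∀ k, 1 ≤ a k := by
    intro k
    have h1 : (1 : ℝ) ≤ lSc l0 θ k := by exact_mod_cast hl.trans (lSc_ge θ k)
    have h2 : (1 : ℝ) ≤ ((lSc l0 θ k : ℝ) ^ d) ^ 2 := one_le_pow₀ (one_le_pow₀ h1)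
    have h4 : (1 : ℝ) ≤ 2 * (2 ^ (k + 1) + 1) := by
      have : (0 : ℝ) ≤ 2 ^ (k + 1) := by positivity
      linarith
    exact one_le_mul_of_one_le_of_one_le h4 h2
  have hlog : ∀ k : ℕ, Real.log (a k) ≤
      (k : ℝ) ^ 1 * Real.log 2 + (3 * Real.log 2 + 2 * d * Real.log l0) +
        (k : ℝ) ^ θ * (2 * d * Real.log 4) := by
    intro k
    have hl0 : (0 : ℝ) < l0 := by exact_mod_cast hl
    have h1 : a k ≤ 2 ^ (k + 3) * ((lSc l0 θ k : ℝ) ^ d) ^ 2 := by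
      apply mul_le_mul_of_nonneg_right _ (by positivity)
      have : (1 : ℝ) ≤ 2 ^ k := one_le_pow₀ (by norm_num)
      rw [pow_add, pow_add]
      linarith
    refine (Real.log_le_log (by linarith [ha1 k]) h1).trans (le_of_eq ?_)
    have h4 : (lSc l0 θ k : ℝ) = l0 * 4 ^ (k ^ θ) := by simp [lSc]
    rw [h4, Real.log_mul (by positivity) (by positivity), Real.log_pow, Real.log_pow,
      Real.log_pow, Real.log_mul (by positivity) (by positivity), Real.log_pow]
    push_cast
    ring
  have hsum : Summable (fun k : ℕ => Real.log (a k) / 2 ^ (k + 1)) := by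
    have hp : ∀ n : ℕ, Summable (fun k : ℕ => (k : ℝ) ^ n * (1 / 2) ^ k) := fun n =>
      summable_pow_mul_geometric_of_norm_lt_one n (by norm_num)
    have hg : Summable (fun k : ℕ =>
        (((k : ℝ) ^ 1 * (1 / 2) ^ k) * (Real.log 2 / 2) +
          ((k : ℝ) ^ 0 * (1 / 2) ^ k) * ((3 * Real.log 2 + 2 * d * Real.log l0) / 2)) +
        ((k : ℝ) ^ θ * (1 / 2) ^ k) * ((2 * d * Real.log 4) / 2)) :=
      (((hp 1).mul_right _).add ((hp 0).mul_right _)).add ((hp θ).mul_right _)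
    apply Summable.of_nonneg_of_le _ _ hg
    · intro k
      exact div_nonneg (Real.log_nonneg (ha1 k)) (by positivity)
    · intro k
      rw [div_le_iff₀ (by positivity)]
      refine (hlog k).trans (le_of_eq ?_)
      have : ((1 : ℝ) / 2) ^ k * 2 ^ (k + 1) = 2 := by
        rw [pow_succ, ← mul_assoc, ← mul_pow]; norm_num
      linear_combination (-( (k : ℝ) ^ 1 * Real.log 2 + (3 * Real.log 2 + 2 * d * Real.log l0) +
        (k : ℝ) ^ θ * (2 * d * Real.log 4)) / 2) * this
  have hnn : ∀ k : ℕ, 0 ≤ Real.log (a k) / 2 ^ (k + 1) := fun k =>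
    div_nonneg (Real.log_nonneg (ha1 k)) (by positivity)
  have hind : ∀ k, cc d l0 θ k ≤
      Real.exp (2 ^ k * ∑ j ∈ Finset.range k, Real.log (a j) / 2 ^ (j + 1)) := by
    intro k
    induction k with
    | zero => simp [cc]
    | succ k ih =>
      have hc := cc_ge_one (d := d) hl θ k
      change a k * (cc d l0 θ k) ^ 2 ≤ _
      calc a k * (cc d l0 θ k) ^ 2
          ≤ Real.exp (Real.log (a k)) *
            (Real.exp (2 ^ k * ∑ j ∈ Finset.range k, Real.log (a j) / 2 ^ (j + 1))) ^ 2 := by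
              rw [Real.exp_log (by linarith [ha1 k])]
              apply mul_le_mul_of_nonneg_left _ (by linarith [ha1 k])
              exact pow_le_pow_left₀ (by linarith) ih 2
        _ = _ := by
              rw [← Real.exp_nat_mul, ← Real.exp_add, Finset.sum_range_succ]
              congr 1
              field_simp
              push_cast
              ring
  refine ⟨Real.exp (∑' j, Real.log (a j) / 2 ^ (j + 1)), ?_, ?_⟩
  · exact Real.one_le_exp (tsum_nonneg hnn)
  · intro k
    refine (hind k).trans ?_
    rw [← Real.exp_nat_mul]
    apply Real.exp_le_exp.2
    push_cast
    apply mul_le_mul_of_nonneg_left _ (by positivity)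
    exact hsum.sum_le_tsum _ (fun j _ => hnn j)

lemma sprinkle (χ : ℝ) (hχ : 0 < χ) (θ : ℕ) (hθ : 1 ≤ θ) (δ : ℝ) (hδ : 0 < δ) :
    ∃ C : ℕ, ∀ r0 : ℕ, C ≤ r0 → ∀ k : ℕ,
      ∏ j ∈ Finset.range k, (1 + (rSc r0 θ j : ℝ) ^ (-χ)) ≤ Real.exp δ := by
  set t : ℝ := (2 : ℝ) ^ (-χ) with ht
  have ht0 : 0 < t := Real.rpow_pos_of_pos (by norm_num) _
  have ht1 : t < 1 := Real.rpow_lt_one_of_one_lt_of_neg (by norm_num) (by linarith)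
  have hK : 0 < (1 - t)⁻¹ := inv_pos.2 (by linarith)
  have hlim : Tendsto (fun n : ℕ => (n : ℝ) ^ (-χ)) atTop (nhds 0) :=
    (tendsto_rpow_neg_atTop hχ).comp tendsto_natCast_atTop_atTop
  have hev : ∀ᶠ n : ℕ in atTop, (n : ℝ) ^ (-χ) < δ / (1 - t)⁻¹ :=
    hlim.eventually_lt_const (by positivity)
  obtain ⟨C, hC⟩ := eventually_atTop.1 hev
  refine ⟨C, fun r0 hr k => ?_⟩
  have h0 : (0 : ℝ) ≤ (r0 : ℝ) ^ (-χ) := by positivity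
  have h1 : ∀ j : ℕ, (rSc r0 θ j : ℝ) ^ (-χ) ≤ (r0 : ℝ) ^ (-χ) * t ^ j := by
    intro j
    have : (rSc r0 θ j : ℝ) = r0 * 2 ^ (j ^ θ) := by simp [rSc]
    rw [this, Real.mul_rpow (by positivity) (by positivity)]
    apply mul_le_mul_of_nonneg_left _ h0
    have h2 : ((2 : ℝ) ^ (j ^ θ)) ^ (-χ) = t ^ (j ^ θ) := by
      rw [ht, ← Real.rpow_natCast, ← Real.rpow_natCast, ← Real.rpow_mul (by norm_num),
        ← Real.rpow_mul (by norm_num), mul_comm]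
    rw [h2]
    exact pow_le_pow_of_le_one ht0.le ht1.le (Nat.le_self_pow (by omega) j)
  calc ∏ j ∈ Finset.range k, (1 + (rSc r0 θ j : ℝ) ^ (-χ))
      ≤ ∏ j ∈ Finset.range k, Real.exp ((r0 : ℝ) ^ (-χ) * t ^ j) := by
        apply Finset.prod_le_prod
        · intro j _; positivity
        · intro j _
          have := Real.add_one_le_exp ((r0 : ℝ) ^ (-χ) * t ^ j)
          linarith [h1 j]
    _ = Real.exp ((r0 : ℝ) ^ (-χ) * ∑ j ∈ Finset.range k, t ^ j) := by
        rw [← Real.exp_sum, Finset.mul_sum]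
    _ ≤ Real.exp δ := by
        apply Real.exp_le_exp.2
        have h3 : ∑ j ∈ Finset.range k, t ^ j ≤ (1 - t)⁻¹ := by
          rw [← tsum_geometric_of_lt_one ht0.le ht1]
          exact (summable_geometric_of_lt_one ht0.le ht1).sum_le_tsum _
            (fun j _ => by positivity)
        have h4 := (hC r0 hr).le
        rw [le_div_iff₀ hK] at h4
        exact (mul_le_mul_of_nonneg_left h3 h0).trans h4

lemma LSc_lower {l0 L0 : ℕ} (hl : 1 ≤ l0) (θ k : ℕ) :
    4 ^ (k ^ θ) * L0 ≤ LSc l0 L0 θ (k + 1) := by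
  change _ ≤ (l0 * 4 ^ (k ^ θ)) * LSc l0 L0 θ k
  apply Nat.mul_le_mul _ (LSc_ge hl θ k)
  exact Nat.le_mul_of_pos_left _ hl

lemma err_bound (ε : ℝ) (hε : 0 < ε) (LP : ℕ) (fP : ℕ → ℝ)
    (hf : ∀ L : ℕ, LP ≤ L → Real.exp ((Real.log L) ^ ε) ≤ fP L) (l0 : ℕ) (hl : 1 ≤ l0)
    (q : ℝ) (hq0 : 0 < q) :
    ∃ C : ℕ, ∀ L0 : ℕ, C ≤ L0 → ∀ k : ℕ,
      Real.exp (-(fP (LSc l0 L0 ⌈1/ε⌉₊ k))) ≤ q ^ (2 ^ (k + 1)) := by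
  set θ := ⌈1/ε⌉₊ with hθ
  -- the required lower bound
  obtain ⟨M, hM1, hM⟩ : ∃ M : ℝ, 1 ≤ M ∧ -Real.log q ≤ M :=
    ⟨max 1 (-Real.log q), le_max_left _ _, le_max_right _ _⟩
  have hlim : Tendsto (fun n : ℕ => (Real.log (n : ℝ)) ^ ε) atTop atTop :=
    (tendsto_rpow_atTop hε).comp (Real.tendsto_log_atTop.comp tendsto_natCast_atTop_atTop)
  have hl2 : Real.log 2 < 1 := by linarith [Real.log_two_lt_d9]
  have hl2' : 0 < Real.log 2 := Real.log_pos (by norm_num)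
  have hl4 : 1 ≤ Real.log 4 := by
    have : (4 : ℝ) = 2 ^ 2 := by norm_num
    rw [this, Real.log_pow]
    have := Real.log_two_gt_d9
    push_cast; linarith
  obtain ⟨C, hC⟩ := eventually_atTop.1 (hlim.eventually_ge_atTop
    ((Real.log M + 2 * Real.log 2) / (1 - Real.log 2)))
  refine ⟨max C (max LP 1), fun L0 hL0 k => ?_⟩
  have hL1 : 1 ≤ L0 := (le_max_right _ _).trans ((le_max_right _ _).trans hL0)
  have hLLP : LP ≤ L0 := (le_max_left _ _).trans ((le_max_right _ _).trans hL0)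
  have hLC : C ≤ L0 := (le_max_left _ _).trans hL0
  have h1 := hf (LSc l0 L0 θ k) (hLLP.trans (LSc_ge hl θ k))
  have hLk : L0 ≤ LSc l0 L0 θ k := LSc_ge hl θ k
  have hL0r : (1 : ℝ) ≤ L0 := by exact_mod_cast hL1
  have hA : (Real.log L0) ^ ε ≤ (Real.log (LSc l0 L0 θ k)) ^ ε := by
    apply Real.rpow_le_rpow (Real.log_nonneg hL0r) _ hε.le
    exact Real.log_le_log (by linarith) (by exact_mod_cast hLk)
  have hB : (k : ℝ) - 1 ≤ (Real.log (LSc l0 L0 θ k)) ^ ε := by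
    cases k with
    | zero =>
      have : 0 ≤ (Real.log (LSc l0 L0 θ 0)) ^ ε :=
        Real.rpow_nonneg (Real.log_natCast_nonneg _) _
      simp only [Nat.cast_zero]; linarith
    | succ k =>
      have h2 : 4 ^ (k ^ θ) ≤ LSc l0 L0 θ (k + 1) :=
        (Nat.le_mul_of_pos_right _ hL1).trans (LSc_lower hl θ k)
      have h3 : (k : ℝ) ^ θ ≤ Real.log (LSc l0 L0 θ (k + 1)) := by
        calc (k : ℝ) ^ θ ≤ (k : ℝ) ^ θ * Real.log 4 :=
              le_mul_of_one_le_right (by positivity) hl4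
          _ = Real.log ((4 : ℝ) ^ (k ^ θ)) := by rw [Real.log_pow]; push_cast; ring
          _ ≤ _ := Real.log_le_log (by positivity) (by exact_mod_cast h2)
      have h4 : ((k : ℝ) ^ θ) ^ ε ≤ (Real.log (LSc l0 L0 θ (k + 1))) ^ ε :=
        Real.rpow_le_rpow (by positivity) h3 hε.le
      refine le_trans ?_ h4
      push_cast
      rw [add_sub_cancel_right, ← Real.rpow_natCast, ← Real.rpow_mul (by positivity)]
      rcases Nat.eq_zero_or_pos k with rfl | hk
      · simp only [Nat.cast_zero]
        exact Real.rpow_nonneg le_rfl _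
      · have hk1 : (1 : ℝ) ≤ k := by exact_mod_cast hk
        have : (1 : ℝ) ≤ θ * ε := by
          have := Nat.le_ceil (1 / ε)
          rw [← hθ, div_le_iff₀ hε] at this
          exact this
        calc (k : ℝ) = (k : ℝ) ^ (1 : ℝ) := (Real.rpow_one _).symm
          _ ≤ _ := Real.rpow_le_rpow_of_exponent_le hk1 this
  have hC' := hC L0 hLC
  rw [div_le_iff₀ (by linarith)] at hC'
  have hkey : Real.log M + ((k : ℝ) + 1) * Real.log 2 ≤ (Real.log (LSc l0 L0 θ k)) ^ ε := by
    set X := (Real.log (LSc l0 L0 θ k)) ^ ε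
    have e1 : (Real.log L0) ^ ε * (1 - Real.log 2) ≤ X * (1 - Real.log 2) :=
      mul_le_mul_of_nonneg_right hA (by linarith)
    have e2 : ((k : ℝ) - 1) * Real.log 2 ≤ X * Real.log 2 :=
      mul_le_mul_of_nonneg_right hB hl2'.le
    linarith
  have hfin : M * 2 ^ (k + 1) ≤ fP (LSc l0 L0 θ k) := by
    refine le_trans ?_ h1
    refine le_trans (le_of_eq ?_) (Real.exp_le_exp.2 hkey)
    rw [Real.exp_add, Real.exp_log (by linarith)]
    congr 1
    have : ((k : ℝ) + 1) * Real.log 2 = ((k + 1 : ℕ) : ℝ) * Real.log 2 := by push_cast; ring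
    rw [this, Real.exp_nat_mul, Real.exp_log (by norm_num)]
  have hlogq : q = Real.exp (Real.log q) := (Real.exp_log hq0).symm
  rw [hlogq, ← Real.exp_nat_mul]
  apply Real.exp_le_exp.2
  push_cast
  have : (0 : ℝ) < 2 ^ (k + 1) := by positivity
  nlinarith

/-! ### Mean ergodic theorem -/

/-- the ergodic averages -/
noncomputable def avgE {α : Type*} (T : α → α) (f : α → ℝ) (n : ℕ) (ω : α) : ℝ :=
  (n : ℝ)⁻¹ * ∑ k ∈ Finset.range n, f (T^[k] ω)

lemma integral_abs_le_of_Lp2 {α : Type*} [MeasurableSpace α] {μ : Measure α}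
    [IsProbabilityMeasure μ] (G : Lp ℝ 2 μ) {h : α → ℝ} (hG : G =ᵐ[μ] h) :
    ∫ ω, |h ω| ∂μ ≤ ‖G‖ := by
  have h1 : ∫ ω, |h ω| ∂μ = ∫ ω, ‖G ω‖ ∂μ := by
    apply integral_congr_ae
    filter_upwards [hG] with ω hω
    rw [hω, Real.norm_eq_abs]
  rw [h1, Lp.norm_def, integral_norm_eq_lintegral_enorm (Lp.aestronglyMeasurable G),
    ← eLpNorm_one_eq_lintegral_enorm]
  apply ENNReal.toReal_mono (Lp.eLpNorm_ne_top G)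
  exact eLpNorm_le_eLpNorm_of_exponent_le (by norm_num) (Lp.aestronglyMeasurable G)

lemma mean_ergodic {α : Type*} [MeasurableSpace α] {μ : Measure α} [IsProbabilityMeasure μ]
    {T : α → α} (hT : Ergodic T μ) {f : α → ℝ} (hf : MemLp f 2 μ) :
    Tendsto (fun n => ∫ ω, |avgE T f n ω - ∫ x, f x ∂μ| ∂μ) atTop (nhds 0) := by
  have hmp : MeasurePreserving T μ μ := hT.toMeasurePreserving
  let U : Lp ℝ 2 μ →L[ℝ] Lp ℝ 2 μ :=
    (Lp.compMeasurePreservingₗᵢ ℝ T hmp).toContinuousLinearMap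
  have hU : ‖U‖ ≤ 1 := LinearIsometry.norm_toContinuousLinearMap_le _
  let F : Lp ℝ 2 μ := hf.toLp f
  have hlim := U.tendsto_birkhoffAverage_orthogonalProjection hU F
  set g : Lp ℝ 2 μ := ((U.eqLocus (1 : Lp ℝ 2 μ →L[ℝ] Lp ℝ 2 μ)).orthogonalProjectionOnto F : Lp ℝ 2 μ) with hg
  have hUg : U g = g := ((U.eqLocus (1 : Lp ℝ 2 μ →L[ℝ] Lp ℝ 2 μ)).orthogonalProjectionOnto F).2
  have hgT : (g : α → ℝ) ∘ T =ᵐ[μ] g := by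
    have h1 : (U g : α → ℝ) =ᵐ[μ] (g : α → ℝ) ∘ T := Lp.coeFn_compMeasurePreserving g hmp
    rw [hUg] at h1
    exact h1.symm
  obtain ⟨c, hc⟩ := hT.ae_eq_const_of_ae_eq_comp_ae (Lp.aestronglyMeasurable g) hgT
  have hiter : ∀ k : ℕ, (U^[k] F : α → ℝ) =ᵐ[μ] fun ω => f (T^[k] ω) := by
    intro k
    have : U^[k] F = (hf.comp_measurePreserving (hmp.iterate k)).toLp _ := by
      induction k with
      | zero => rfl
      | succ k ih =>
        rw [Function.iterate_succ_apply', ih]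
        rfl
    rw [this]
    exact MemLp.coeFn_toLp _
  have hsum : ∀ n : ℕ, ((∑ k ∈ Finset.range n, U^[k] F : Lp ℝ 2 μ) : α → ℝ) =ᵐ[μ]
      fun ω => ∑ k ∈ Finset.range n, f (T^[k] ω) := by
    intro n
    induction n with
    | zero =>
      simp only [Finset.range_zero, Finset.sum_empty]
      exact Lp.coeFn_zero _ _ _
    | succ n ih =>
      rw [Finset.sum_range_succ]
      filter_upwards [Lp.coeFn_add (∑ k ∈ Finset.range n, U^[k] F) (U^[n] F), ih, hiter n]
        with ω h1 h2 h3
      rw [h1, Pi.add_apply, h2, h3, Finset.sum_range_succ]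
  have havg : ∀ n : ℕ, ((birkhoffAverage ℝ U _root_.id n F - g : Lp ℝ 2 μ) : α → ℝ) =ᵐ[μ]
      fun ω => avgE T f n ω - c := by
    intro n
    have e : birkhoffAverage ℝ U _root_.id n F = (n : ℝ)⁻¹ • ∑ k ∈ Finset.range n, U^[k] F := rfl
    rw [e]
    filter_upwards [Lp.coeFn_sub ((n : ℝ)⁻¹ • ∑ k ∈ Finset.range n, U^[k] F) g,
      Lp.coeFn_smul ((n : ℝ)⁻¹) (∑ k ∈ Finset.range n, U^[k] F), hsum n, hc] with ω h1 h2 h3 h4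
    rw [h1, Pi.sub_apply, h2, Pi.smul_apply, h3, h4]
    rfl
  have hnorm : Tendsto (fun n => ‖birkhoffAverage ℝ U _root_.id n F - g‖) atTop (nhds 0) :=
    tendsto_iff_norm_sub_tendsto_zero.1 hlim
  have hlimc : Tendsto (fun n => ∫ ω, |avgE T f n ω - c| ∂μ) atTop (nhds 0) :=
    squeeze_zero (fun n => integral_nonneg (fun _ => abs_nonneg _))
      (fun n => integral_abs_le_of_Lp2 _ (havg n)) hnorm
  have hint : Integrable f μ := hf.integrable (by norm_num)
  have hint' : ∀ k : ℕ, Integrable (fun ω => f (T^[k] ω)) μ := fun k =>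
    (hmp.iterate k).integrable_comp_of_integrable hint
  have hintk : ∀ k : ℕ, ∫ ω, f (T^[k] ω) ∂μ = ∫ ω, f ω ∂μ := by
    intro k
    have hm := (hmp.iterate k)
    have := integral_map (μ := μ) (φ := T^[k]) hm.measurable.aemeasurable
      (f := f) (by rw [hm.map_eq]; exact hf.aestronglyMeasurable)
    rw [hm.map_eq] at this
    exact this.symm
  have hcI : c = ∫ x, f x ∂μ := by
    have h1 : ∀ n : ℕ, 1 ≤ n → |∫ x, f x ∂μ - c| ≤ ∫ ω, |avgE T f n ω - c| ∂μ := by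
      intro n hn
      have hn' : (n : ℝ) ≠ 0 := by positivity
      have hI : Integrable (fun ω => avgE T f n ω) μ :=
        (integrable_finsetSum _ (fun k _ => hint' k)).const_mul _
      have h2 : ∫ ω, (avgE T f n ω - c) ∂μ = ∫ x, f x ∂μ - c := by
        rw [integral_sub hI (integrable_const c)]
        unfold avgE
        rw [integral_const_mul, integral_finsetSum _ (fun k _ => hint' k)]
        simp only [hintk]
        simp
        field_simp
      rw [← h2]
      exact abs_integral_le_integral_abs
    have h2 : |∫ x, f x ∂μ - c| ≤ 0 :=
      ge_of_tendsto hlimc (eventually_atTop.2 ⟨1, h1⟩)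
    have := abs_nonpos_iff.1 h2
    linarith
  rw [← hcI]
  exact hlimc

/-! ### Spatial averages -/

lemma shift_mp {μ : Measure (Config d)} (hE : ∀ x : Pt d, x ≠ 0 → Ergodic (shift x) μ) (x : Pt d) :
    MeasurePreserving (shift x) μ μ := by
  by_cases h : x = 0
  · subst h
    have : (shift (0 : Pt d)) = id := by funext ω; exact shift_zero ω
    rw [this]
    exact MeasurePreserving.id μ
  · exact (hE x h).toMeasurePreserving

lemma shift_iterate (v : Pt d) (k : ℕ) (ω : Config d) : (shift v)^[k] ω = shift (k • v) ω := by
  induction k with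
  | zero => simp [shift_zero]
  | succ k ih =>
    rw [Function.iterate_succ_apply', ih, shift_shift, succ_nsmul]

lemma markov_tendsto {α : Type*} [MeasurableSpace α] {μ : Measure α} [IsProbabilityMeasure μ]
    (X : ℕ → α → ℝ) (hX : ∀ n, Integrable (X n) μ)
    (hlim : Tendsto (fun n => ∫ ω, |X n ω| ∂μ) atTop (nhds 0)) (c : ℝ) (hc : 0 < c)
    (S : ℕ → Set α) (hS : ∀ᶠ n in atTop, ∀ ω ∈ S n, c ≤ |X n ω|) :
    Tendsto (fun n => μ.real (S n)) atTop (nhds 0) := by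
  have h1 : Tendsto (fun n => c⁻¹ * ∫ ω, |X n ω| ∂μ) atTop (nhds 0) := by
    simpa using hlim.const_mul c⁻¹
  refine squeeze_zero' (Eventually.of_forall (fun n => measureReal_nonneg)) ?_ h1
  filter_upwards [hS] with n hn
  have h2 : c * μ.real {ω | c ≤ |X n ω|} ≤ ∫ ω, |X n ω| ∂μ :=
    mul_meas_ge_le_integral_of_nonneg (Eventually.of_forall (fun _ => abs_nonneg _)) (hX n).abs c
  have h3 : μ.real (S n) ≤ μ.real {ω | c ≤ |X n ω|} :=
    measureReal_mono (fun ω hω => hn ω hω) (measure_ne_top _ _)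
  rw [le_inv_mul_iff₀ hc]
  exact (mul_le_mul_of_nonneg_left h3 hc.le).trans h2

lemma memLp_ind {μ : Measure (Config d)} [IsProbabilityMeasure μ] {A : Set (Config d)}
    (hA : MeasurableSet A) : MemLp (A.indicator (fun _ => (1 : ℝ))) 2 μ :=
  memLp_indicator_const 2 hA 1 (Or.inr (measure_ne_top _ _))

lemma integral_ind {μ : Measure (Config d)} [IsProbabilityMeasure μ] {A : Set (Config d)}
    (hA : MeasurableSet A) : ∫ ω, A.indicator (fun _ => (1 : ℝ)) ω ∂μ = μ.real A := by
  rw [integral_indicator hA]; simp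

lemma integrable_ind_shift {μ : Measure (Config d)} [IsProbabilityMeasure μ]
    {A : Set (Config d)} (hA : MeasurableSet A) (v : Pt d) :
    Integrable (fun ω => A.indicator (fun _ => (1 : ℝ)) (shift v ω)) μ := by
  have h : (fun ω => A.indicator (fun _ => (1 : ℝ)) (shift v ω)) =
      (shift v ⁻¹' A).indicator (fun _ => (1 : ℝ)) := by
    funext ω; rfl
  rw [h]
  exact (integrable_const 1).indicator (measurable_shift v hA)

/-- line averages -/
noncomputable def lineAvg (A : Set (Config d)) (v : Pt d) (n : ℕ) (ω : Config d) : ℝ :=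
  (n : ℝ)⁻¹ * ∑ k ∈ Finset.range n, A.indicator (fun _ => (1 : ℝ)) (shift (k • v) ω)

/-- box averages -/
noncomputable def boxAvg (A : Set (Config d)) (n : ℕ) (ω : Config d) : ℝ :=
  ((n : ℝ) ^ d)⁻¹ * ∑ y : Fin d → Fin n,
    A.indicator (fun _ => (1 : ℝ)) (shift (fun i => ((y i : ℕ) : ℤ)) ω)

lemma lineAvg_integrable {μ : Measure (Config d)} [IsProbabilityMeasure μ]
    {A : Set (Config d)} (hA : MeasurableSet A) (v : Pt d) (n : ℕ) :
    Integrable (lineAvg A v n) μ :=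
  (integrable_finsetSum _ (fun k _ => integrable_ind_shift hA (k • v))).const_mul _

lemma boxAvg_integrable {μ : Measure (Config d)} [IsProbabilityMeasure μ]
    {A : Set (Config d)} (hA : MeasurableSet A) (n : ℕ) :
    Integrable (boxAvg A n) μ :=
  (integrable_finsetSum _ (fun y _ => integrable_ind_shift hA _)).const_mul _

lemma lineAvg_tendsto {μ : Measure (Config d)} [IsProbabilityMeasure μ]
    {A : Set (Config d)} (hA : MeasurableSet A) (v : Pt d) (hE : Ergodic (shift v) μ) :
    Tendsto (fun n => ∫ ω, |lineAvg A v n ω - μ.real A| ∂μ) atTop (nhds 0) := by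
  have := mean_ergodic hE (memLp_ind (μ := μ) hA)
  rw [integral_ind hA] at this
  convert this using 7 with n ω
  unfold lineAvg avgE
  simp only [shift_iterate]

lemma sum_update (n : ℕ) (i0 : Fin d) (g : (Fin d → Fin n) → ℝ) :
    ∑ y : Fin d → Fin n, ∑ k : Fin n, g (Function.update y i0 k) = n * ∑ y, g y := by
  rw [← Fintype.sum_prod_type' (f := fun (y : Fin d → Fin n) (k : Fin n) =>
    g (Function.update y i0 k))]
  let e : ((Fin d → Fin n) × Fin n) ≃ ((Fin d → Fin n) × Fin n) :=
    { toFun := fun p => (Function.update p.1 i0 p.2, p.1 i0)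
      invFun := fun p => (Function.update p.1 i0 p.2, p.1 i0)
      left_inv := by rintro ⟨y, k⟩; simp
      right_inv := by rintro ⟨y, k⟩; simp }
  have h1 : ∑ p : (Fin d → Fin n) × Fin n, g (Function.update p.1 i0 p.2) =
      ∑ p : (Fin d → Fin n) × Fin n, g p.1 :=
    Equiv.sum_comp e (fun p => g p.1)
  rw [h1, Fintype.sum_prod_type, Finset.mul_sum]
  simp

lemma boxAvg_le {μ : Measure (Config d)} [IsProbabilityMeasure μ]
    (hE : ∀ x : Pt d, x ≠ 0 → Ergodic (shift x) μ)
    {A : Set (Config d)} (hA : MeasurableSet A) (i0 : Fin d) (n : ℕ) (hn : 1 ≤ n) :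
    ∫ ω, |boxAvg A n ω - μ.real A| ∂μ ≤ ∫ ω, |lineAvg A (unitVec i0) n ω - μ.real A| ∂μ := by
  set p := μ.real A
  have hn' : (0 : ℝ) < n := by exact_mod_cast hn
  let y0 : (Fin d → Fin n) → Pt d := fun y => Function.update (fun i => ((y i : ℕ) : ℤ)) i0 0
  have hrep : ∀ ω, boxAvg A n ω - p = ((n : ℝ) ^ d)⁻¹ * ∑ y : Fin d → Fin n,
      (lineAvg A (unitVec i0) n (shift (y0 y) ω) - p) := by
    intro ω
    rw [Finset.sum_sub_distrib, mul_sub]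
    have h1 : ((n : ℝ) ^ d)⁻¹ * ∑ _y : Fin d → Fin n, p = p := by
      simp
      field_simp
    rw [h1]
    congr 1
    unfold boxAvg
    congr 1
    have h2 := sum_update n i0 (fun y : Fin d → Fin n =>
      A.indicator (fun _ => (1 : ℝ)) (shift (fun i => ((y i : ℕ) : ℤ)) ω))
    have h3 : ∀ y : Fin d → Fin n, lineAvg A (unitVec i0) n (shift (y0 y) ω) =
        (n : ℝ)⁻¹ * ∑ k : Fin n, A.indicator (fun _ => (1 : ℝ))
          (shift (fun i => ((Function.update y i0 k i : ℕ) : ℤ)) ω) := by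
      intro y
      unfold lineAvg
      rw [← Fin.sum_univ_eq_sum_range (fun k => A.indicator (fun _ => (1 : ℝ))
        (shift (k • unitVec i0) (shift (y0 y) ω)))]
      congr 1
      apply Finset.sum_congr rfl
      intro k _
      rw [shift_shift]
      congr 2
      funext i
      by_cases hi : i = i0
      · subst hi
        simp [y0, unitVec]
      · simp [y0, unitVec, hi]
    simp only [h3]
    rw [← Finset.mul_sum, h2]
    field_simp
  have hli : ∀ v, Integrable (fun ω => |lineAvg A (unitVec i0) n (shift v ω) - p|) μ := by
    intro v
    exact (shift_mp hE v).integrable_comp_of_integrable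
      ((lineAvg_integrable hA (unitVec i0) n).sub (integrable_const p)).abs
  have hle : ∀ v, ∫ ω, |lineAvg A (unitVec i0) n (shift v ω) - p| ∂μ =
      ∫ ω, |lineAvg A (unitVec i0) n ω - p| ∂μ := by
    intro v
    have hm := shift_mp hE v
    have hint : Integrable (fun ω => |lineAvg A (unitVec i0) n ω - p|) μ :=
      ((lineAvg_integrable hA (unitVec i0) n).sub (integrable_const p)).abs
    have := integral_map (μ := μ) (φ := shift v) hm.measurable.aemeasurable
      (f := fun ω => |lineAvg A (unitVec i0) n ω - p|)
      (by rw [hm.map_eq]; exact hint.aestronglyMeasurable)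
    rw [hm.map_eq] at this
    exact this.symm
  calc ∫ ω, |boxAvg A n ω - p| ∂μ
      ≤ ∫ ω, ((n : ℝ) ^ d)⁻¹ * ∑ y : Fin d → Fin n,
        |lineAvg A (unitVec i0) n (shift (y0 y) ω) - p| ∂μ := by
        apply integral_mono
        · exact ((boxAvg_integrable hA n).sub (integrable_const p)).abs
        · exact (integrable_finsetSum _ (fun y _ => hli _)).const_mul _
        · intro ω
          change |boxAvg A n ω - p| ≤ _
          rw [hrep ω, abs_mul, abs_of_nonneg (a := ((n : ℝ) ^ d)⁻¹) (by positivity)]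
          exact mul_le_mul_of_nonneg_left (Finset.abs_sum_le_sum_abs _ _) (by positivity)
    _ = _ := by
        rw [integral_const_mul, integral_finsetSum _ (fun y _ => hli _)]
        simp only [hle]
        simp
        field_simp

lemma boxAvg_tendsto {μ : Measure (Config d)} [IsProbabilityMeasure μ]
    (hE : ∀ x : Pt d, x ≠ 0 → Ergodic (shift x) μ)
    {A : Set (Config d)} (hA : MeasurableSet A) (hd : 1 ≤ d) :
    Tendsto (fun n => ∫ ω, |boxAvg A n ω - μ.real A| ∂μ) atTop (nhds 0) := by
  let i0 : Fin d := ⟨0, hd⟩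
  have hu : (unitVec i0 : Pt d) ≠ 0 := by
    intro h
    have := congrFun h i0
    simp [unitVec] at this
  refine squeeze_zero' (Eventually.of_forall (fun n => integral_nonneg (fun _ => abs_nonneg _)))
    ?_ (lineAvg_tendsto hA (unitVec i0) (hE _ hu))
  filter_upwards [eventually_ge_atTop 1] with n hn
  exact boxAvg_le hE hA i0 n hn

lemma boxAvg_low {μ : Measure (Config d)} [IsProbabilityMeasure μ]
    (hE : ∀ x : Pt d, x ≠ 0 → Ergodic (shift x) μ)
    {A : Set (Config d)} (hA : MeasurableSet A) (hd : 1 ≤ d) (c : ℝ) (hc : c < μ.real A) :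
    Tendsto (fun n => μ.real {ω | boxAvg A n ω ≤ c}) atTop (nhds 0) := by
  apply markov_tendsto (fun n ω => boxAvg A n ω - μ.real A)
    (fun n => (boxAvg_integrable hA n).sub (integrable_const _)) (boxAvg_tendsto hE hA hd)
    (μ.real A - c) (by linarith)
  refine Eventually.of_forall (fun n ω hω => ?_)
  have : boxAvg A n ω ≤ c := hω
  rw [abs_sub_comm]
  exact le_trans (by linarith) (le_abs_self _)

lemma boxAvg_high {μ : Measure (Config d)} [IsProbabilityMeasure μ]
    (hE : ∀ x : Pt d, x ≠ 0 → Ergodic (shift x) μ)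
    {A : Set (Config d)} (hA : MeasurableSet A) (hd : 1 ≤ d) (c : ℝ) (hc : μ.real A < c) :
    Tendsto (fun n => μ.real {ω | c ≤ boxAvg A n ω}) atTop (nhds 0) := by
  apply markov_tendsto (fun n ω => boxAvg A n ω - μ.real A)
    (fun n => (boxAvg_integrable hA n).sub (integrable_const _)) (boxAvg_tendsto hE hA hd)
    (c - μ.real A) (by linarith)
  refine Eventually.of_forall (fun n ω hω => ?_)
  have : c ≤ boxAvg A n ω := hω
  exact le_trans (by linarith) (le_abs_self _)

lemma line_empty {μ : Measure (Config d)} [IsProbabilityMeasure μ]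
    (hE : ∀ x : Pt d, x ≠ 0 → Ergodic (shift x) μ)
    {A : Set (Config d)} (hA : MeasurableSet A) (i : Fin d) (hp : 0 < μ.real A) :
    Tendsto (fun n => μ.real {ω | ∀ k : ℕ, k < n → shift (k • unitVec i) ω ∉ A})
      atTop (nhds 0) := by
  have hu : (unitVec i : Pt d) ≠ 0 := by
    intro h
    have := congrFun h i
    simp [unitVec] at this
  apply markov_tendsto (fun n ω => lineAvg A (unitVec i) n ω - μ.real A)
    (fun n => (lineAvg_integrable hA _ n).sub (integrable_const _))
    (lineAvg_tendsto hA (unitVec i) (hE _ hu)) (μ.real A) hp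
  refine Eventually.of_forall (fun n ω hω => ?_)
  have h0 : lineAvg A (unitVec i) n ω = 0 := by
    unfold lineAvg
    rw [Finset.sum_eq_zero, mul_zero]
    intro k hk
    exact Set.indicator_of_notMem (hω k (Finset.mem_range.1 hk)) _
  change _ ≤ |lineAvg A (unitVec i) n ω - μ.real A|
  rw [h0, zero_sub, abs_neg]
  exact le_abs_self _

/-! ### The monotone seed event -/

/-- An increasing version of the event `eventAMod`. -/
def eventA' (d : ℕ) (η : ℝ) (L0 : ℕ) (x : Pt d) : Set (Config d) :=
  {ω | ∃ w : (Fin d → Bool) → Pt d,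
    (∀ e, w e ∈ Sr ω (L0 : ℝ) ∩ box (subCorner x L0 e) L0) ∧
    (∀ e, (3/4 : ℝ) * η * (L0 : ℝ) ^ d ≤
      (cluster (Sr ω (L0 : ℝ) ∩ box (subCorner x L0 e) L0) (w e)).ncard) ∧
    (∀ e e', connIn (SS ω ∩ box x (2 * L0)) (w e) (w e')) ∧
    (∀ i : Fin d, (cluster (Sr ω (L0 : ℝ) ∩ box (subCorner x L0 (fun _ => false)) L0)
      (w (fun _ => false)) ∩ segmentI x L0 i).Nonempty)}

lemma subCorner_false (x : Pt d) (L0 : ℕ) : subCorner x L0 (fun _ => false) = x := by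
  funext i; simp [subCorner]

lemma subCorner_apply (x : Pt d) (L0 : ℕ) (e : Fin d → Bool) (i : Fin d) :
    subCorner x L0 e i = x i ∨ subCorner x L0 e i = x i + L0 := by
  unfold subCorner
  by_cases h : e i <;> simp [h]

lemma subBox_subset (x : Pt d) (L0 : ℕ) (e : Fin d → Bool) :
    box (subCorner x L0 e) L0 ⊆ box x (2 * L0) := by
  intro y hy i
  have h1 := hy i
  push_cast
  rcases subCorner_apply x L0 e i with h | h <;> rw [h] at h1 <;> constructor <;> omega

lemma eventA'_inc (η : ℝ) (L0 : ℕ) (x : Pt d) : IncreasingEvent (eventA' d η L0 x) := by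
  rintro ω ω' h ⟨w, h1, h2, h3, h4⟩
  have hS : ∀ e, Sr ω (L0 : ℝ) ∩ box (subCorner x L0 e) L0 ⊆
      Sr ω' (L0 : ℝ) ∩ box (subCorner x L0 e) L0 := fun e =>
    Set.inter_subset_inter_left _ (Sr_mono h _)
  refine ⟨w, fun e => hS e (h1 e), fun e => ?_, fun e e' => ?_, fun i => ?_⟩
  · refine (h2 e).trans ?_
    have := Set.ncard_le_ncard (cluster_mono (hS e) (w e))
      ((box_finite (subCorner x L0 e) L0).subset
        ((cluster_subset _ _).trans Set.inter_subset_right))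
    exact_mod_cast this
  · exact (h3 e e').mono (Set.inter_subset_inter_left _ (SS_mono h))
  · exact (h4 i).mono (Set.inter_subset_inter_left _ (cluster_mono (hS _) _))

lemma eventB_dec (η : ℝ) (L0 : ℕ) (x : Pt d) : DecreasingEvent (eventB d η L0 x) := by
  intro ω ω' h hB e
  refine le_trans ?_ (hB e)
  have hS : Sr ω' (L0 : ℝ) ∩ box (subCorner x L0 e) L0 ⊆
      Sr ω (L0 : ℝ) ∩ box (subCorner x L0 e) L0 :=
    Set.inter_subset_inter_left _ (Sr_mono h _)
  have := Set.ncard_le_ncard hS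
    ((box_finite (subCorner x L0 e) L0).subset Set.inter_subset_right)
  exact_mod_cast this

lemma ball_in_box {x y : Pt d} {L0 : ℕ} (hy : y ∈ box x (2 * L0)) :
    ballZ y L0 ⊆ ballZ x (3 * L0) := by
  apply ballZ_subset
  have : distInf x y ≤ 2 * L0 := by
    rw [distInf_le_iff]
    intro i
    have := hy i
    push_cast at this
    omega
  omega

lemma local_sets {ω ω' : Config d} {x : Pt d} {L0 : ℕ}
    (h : ∀ y ∈ ballZ x (3 * L0), ω y = ω' y) :
    (∀ e, Sr ω (L0 : ℝ) ∩ box (subCorner x L0 e) L0 =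
      Sr ω' (L0 : ℝ) ∩ box (subCorner x L0 e) L0) ∧
    SS ω ∩ box x (2 * L0) = SS ω' ∩ box x (2 * L0) := by
  constructor
  · intro e
    exact Sr_inter_congr (fun y hy => ball_in_box (subBox_subset x L0 e hy)) h
  · apply SS_inter_congr
    intro y hy
    exact h y (ball_in_box hy (mem_ballZ_self _ _))

lemma eventA'_dep (η : ℝ) (L0 : ℕ) (x : Pt d) :
    DependsOn (eventA' d η L0 x) (ballZ x (3 * L0)) := by
  intro ω ω' h
  obtain ⟨h1, h2⟩ := local_sets h
  simp only [eventA', Set.mem_ofPred_eq, h1, h2]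

lemma eventB_dep (η : ℝ) (L0 : ℕ) (x : Pt d) :
    DependsOn (eventB d η L0 x) (ballZ x (3 * L0)) := by
  intro ω ω' h
  obtain ⟨h1, h2⟩ := local_sets h
  simp only [eventB, Set.mem_ofPred_eq, h1]

lemma cluster_eq_of_mem {T : Set (Pt d)} {x y : Pt d} (h : connIn T x y) :
    cluster T x = cluster T y := by
  ext z
  exact ⟨fun hz => h.symm.trans hz, fun hz => h.trans hz⟩

lemma big_unique {ω : Config d} {η : ℝ} (hη : 0 < η) {L0 : ℕ} (hL0 : 1 ≤ L0) {x : Pt d}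
    (hB : ω ∈ eventB d η L0 x) (e : Fin d → Bool) {w w' : Pt d}
    (hb : (3/4 : ℝ) * η * (L0 : ℝ) ^ d ≤
      (cluster (Sr ω (L0 : ℝ) ∩ box (subCorner x L0 e) L0) w).ncard)
    (hb' : (3/4 : ℝ) * η * (L0 : ℝ) ^ d ≤
      (cluster (Sr ω (L0 : ℝ) ∩ box (subCorner x L0 e) L0) w').ncard) :
    cluster (Sr ω (L0 : ℝ) ∩ box (subCorner x L0 e) L0) w =
      cluster (Sr ω (L0 : ℝ) ∩ box (subCorner x L0 e) L0) w' := by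
  set T := Sr ω (L0 : ℝ) ∩ box (subCorner x L0 e) L0 with hT
  have hTf : T.Finite := (box_finite (subCorner x L0 e) L0).subset Set.inter_subset_right
  by_cases hdis : Disjoint (cluster T w) (cluster T w')
  · exfalso
    have h1 := Set.ncard_union_eq hdis (hTf.subset (cluster_subset _ _))
      (hTf.subset (cluster_subset _ _))
    have h2 : (cluster T w ∪ cluster T w').ncard ≤ T.ncard :=
      Set.ncard_le_ncard (Set.union_subset (cluster_subset _ _) (cluster_subset _ _)) hTf
    have h3 := hB e
    rw [← hT] at h3
    have h4 : ((cluster T w).ncard : ℝ) + (cluster T w').ncard ≤ T.ncard := by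
      rw [h1] at h2; exact_mod_cast h2
    have h5 : (0 : ℝ) < η * (L0 : ℝ) ^ d := by
      have : (0 : ℝ) < L0 := by exact_mod_cast hL0
      positivity
    linarith
  · rw [Set.not_disjoint_iff] at hdis
    obtain ⟨z, hz, hz'⟩ := hdis
    rw [cluster_eq_of_mem hz, cluster_eq_of_mem hz']

lemma A'_inter_B_subset {η : ℝ} (hη : 0 < η) {L0 : ℕ} (hL0 : 1 ≤ L0) (x : Pt d) :
    eventA' d η L0 x ∩ eventB d η L0 x ⊆ eventAMod d η L0 x := by
  rintro ω ⟨⟨w, h1, h2, h3, h4⟩, hB⟩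
  have hbig : ∀ e C, bigCompIn ω η L0 (box (subCorner x L0 e) L0) C →
      C = cluster (Sr ω (L0 : ℝ) ∩ box (subCorner x L0 e) L0) (w e) := by
    rintro e C ⟨⟨v, hv, rfl⟩, hC⟩
    exact big_unique hη hL0 hB e hC (h2 e)
  refine ⟨⟨fun e => ⟨_, ⟨w e, h1 e, rfl⟩, h2 e⟩, ?_⟩, ?_⟩
  · intro e e' C C' y z hC hC' hy hz
    rw [hbig e C hC] at hy
    rw [hbig e' C' hC'] at hz
    have hsub : ∀ e, Sr ω (L0 : ℝ) ∩ box (subCorner x L0 e) L0 ⊆ SS ω ∩ box x (2 * L0) :=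
      fun e => Set.inter_subset_inter (Sr_subset_SS _ _) (subBox_subset x L0 e)
    have hy' := connIn.mono (hsub e) hy
    have hz' := connIn.mono (hsub e') hz
    exact (hy'.symm.trans (h3 e e')).trans hz'
  · intro i C hC
    have h5 := hbig (fun _ => false) C (by rwa [subCorner_false])
    rw [h5]
    exact h4 i

/-! ### Connectivity on a grid -/

lemma grid_conn (ω : Config d) (x0 : Pt d) (s : ℕ) (r2 : ℝ) (hr2 : r2 ≤ s) (lo hi : ℤ)
    (G1 : ∀ m : Pt d, (∀ i, lo ≤ m i ∧ m i ≤ hi) →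
      (Sr ω (s : ℝ) ∩ ballZ (fun i => x0 i + s * m i) s).Nonempty)
    (G2 : ∀ m : Pt d, (∀ i, lo ≤ m i ∧ m i ≤ hi) →
      ∀ p ∈ Sr ω r2 ∩ ballZ (fun i => x0 i + s * m i) (2 * s),
      ∀ q ∈ Sr ω r2 ∩ ballZ (fun i => x0 i + s * m i) (2 * s),
        connIn (SS ω ∩ ballZ (fun i => x0 i + s * m i) (4 * s)) p q)
    (W : Set (Pt d)) (hW : ∀ m : Pt d, (∀ i, lo ≤ m i ∧ m i ≤ hi) →
      ballZ (fun i => x0 i + s * m i) (4 * s) ⊆ W) :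
    ∀ (N : ℕ) (m m' : Pt d), distInf m m' ≤ N → (∀ i, lo ≤ m i ∧ m i ≤ hi) →
      (∀ i, lo ≤ m' i ∧ m' i ≤ hi) →
      ∀ p ∈ Sr ω r2 ∩ ballZ (fun i => x0 i + s * m i) (2 * s),
      ∀ q ∈ Sr ω r2 ∩ ballZ (fun i => x0 i + s * m' i) (2 * s), connIn (SS ω ∩ W) p q := by
  intro N
  induction N with
  | zero =>
    intro m m' hmm hm hm' p hp q hq
    have : m = m' := by
      funext i
      have := distInf_le_iff.1 hmm i
      omega
    subst this
    exact (G2 m hm p hp q hq).mono (Set.inter_subset_inter_right _ (hW m hm))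
  | succ N ih =>
    intro m m' hmm hm hm' p hp q hq
    rw [distInf_le_iff] at hmm
    let m2 : Pt d := fun i => if m i < m' i then m i + 1 else if m' i < m i then m i - 1 else m i
    have hm2 : ∀ i, lo ≤ m2 i ∧ m2 i ≤ hi := by
      intro i
      have := hm i
      have := hm' i
      simp only [m2]
      split_ifs <;> omega
    have hd2 : distInf m2 m' ≤ N := by
      rw [distInf_le_iff]
      intro i
      have := hmm i
      simp only [m2]
      split_ifs <;> omega
    have hstep : ∀ i, (m i - m2 i).natAbs ≤ 1 := by
      intro i
      simp only [m2]
      split_ifs <;> omega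
    obtain ⟨v, hv1, hv2⟩ := G1 m2 hm2
    have hvr : v ∈ Sr ω r2 := Sr_anti ω hr2 hv1
    have hv3 : v ∈ ballZ (fun i => x0 i + s * m2 i) (2 * s) := by
      rw [mem_ballZ] at *
      intro i
      have := hv2 i
      omega
    have hv4 : v ∈ ballZ (fun i => x0 i + s * m i) (2 * s) := by
      rw [mem_ballZ] at *
      intro i
      have h1 := hv2 i
      have h2 := hstep i
      have h3 : m i = m2 i ∨ m i = m2 i + 1 ∨ m i = m2 i - 1 := by omega
      rcases h3 with h3 | h3 | h3
      · simp only [h3]; omega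
      · simp only [h3, mul_add, mul_one] at *; omega
      · simp only [h3, mul_sub, mul_one] at *; omega
    have c1 := (G2 m hm p hp v ⟨hvr, hv4⟩).mono (Set.inter_subset_inter_right _ (hW m hm))
    have c2 := ih m2 m' hd2 hm2 hm' v ⟨hvr, hv3⟩ q hq
    exact c1.trans c2

lemma cover1 (s lo hi t : ℤ) (hs : 0 < s) (hlh : lo ≤ hi) (h1 : lo * s - 2 * s ≤ t)
    (h2 : t ≤ hi * s + 2 * s) :
    ∃ m, lo ≤ m ∧ m ≤ hi ∧ (s * m - t).natAbs ≤ 2 * s.natAbs := by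
  by_cases ha : t ≤ lo * s
  · refine ⟨lo, le_rfl, hlh, ?_⟩
    rw [mul_comm s lo]; omega
  by_cases hb : hi * s ≤ t
  · refine ⟨hi, hlh, le_rfl, ?_⟩
    rw [mul_comm s hi]; omega
  refine ⟨t / s, ?_, ?_, ?_⟩
  · rw [Int.le_ediv_iff_mul_le hs]; omega
  · have : t / s < hi := by rw [Int.ediv_lt_iff_lt_mul hs]; omega
    omega
  · have h3 := Int.mul_ediv_add_emod t s
    have h4 := Int.emod_nonneg t hs.ne'
    have h5 := Int.emod_lt_of_pos t hs
    omega

lemma grid_conn' (ω : Config d) (x0 : Pt d) (s : ℕ) (hs : 1 ≤ s) (r2 : ℝ) (hr2 : r2 ≤ s)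
    (lo hi : ℤ) (hlh : lo ≤ hi)
    (G1 : ∀ m : Pt d, (∀ i, lo ≤ m i ∧ m i ≤ hi) →
      (Sr ω (s : ℝ) ∩ ballZ (fun i => x0 i + s * m i) s).Nonempty)
    (G2 : ∀ m : Pt d, (∀ i, lo ≤ m i ∧ m i ≤ hi) →
      ∀ p ∈ Sr ω r2 ∩ ballZ (fun i => x0 i + s * m i) (2 * s),
      ∀ q ∈ Sr ω r2 ∩ ballZ (fun i => x0 i + s * m i) (2 * s),
        connIn (SS ω ∩ ballZ (fun i => x0 i + s * m i) (4 * s)) p q)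
    (W : Set (Pt d)) (hW : ∀ m : Pt d, (∀ i, lo ≤ m i ∧ m i ≤ hi) →
      ballZ (fun i => x0 i + s * m i) (4 * s) ⊆ W)
    {p q : Pt d} (hp : p ∈ Sr ω r2) (hq : q ∈ Sr ω r2)
    (hp' : ∀ i, lo * s - 2 * s ≤ p i - x0 i ∧ p i - x0 i ≤ hi * s + 2 * s)
    (hq' : ∀ i, lo * s - 2 * s ≤ q i - x0 i ∧ q i - x0 i ≤ hi * s + 2 * s) :
    connIn (SS ω ∩ W) p q := by
  have hcov : ∀ p : Pt d, (∀ i, lo * s - 2 * s ≤ p i - x0 i ∧ p i - x0 i ≤ hi * s + 2 * s) →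
      ∃ m : Pt d, (∀ i, lo ≤ m i ∧ m i ≤ hi) ∧
        p ∈ ballZ (fun i => x0 i + s * m i) (2 * s) := by
    intro p hp
    have : ∀ i, ∃ m : ℤ, lo ≤ m ∧ m ≤ hi ∧ (s * m - (p i - x0 i)).natAbs ≤ 2 * (s : ℤ).natAbs :=
      fun i => cover1 s lo hi (p i - x0 i) (by omega) hlh (hp i).1 (hp i).2
    choose m hm using this
    refine ⟨m, fun i => ⟨(hm i).1, (hm i).2.1⟩, ?_⟩
    rw [mem_ballZ]
    intro i
    have := (hm i).2.2
    omega
  obtain ⟨m, hm, hpm⟩ := hcov p hp'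
  obtain ⟨m', hm', hqm⟩ := hcov q hq'
  exact grid_conn ω x0 s r2 hr2 lo hi G1 G2 W hW _ m m' le_rfl hm hm' p ⟨hp, hpm⟩ q ⟨hq, hqm⟩

/-! ### Counting -/

lemma boxAvg_count (F : Config d → Set (Pt d)) (hF : ∀ v ω, (0 : Pt d) ∈ F (shift v ω) ↔ v ∈ F ω)
    (N : ℕ) (hN : 1 ≤ N) (z : Pt d) (ω : Config d) :
    (N : ℝ) ^ d * boxAvg {ω | (0 : Pt d) ∈ F ω} N (shift z ω) = ((F ω ∩ box z N).ncard : ℝ) := by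
  classical
  let φ : (Fin d → Fin N) → Pt d := fun y i => z i + ((y i : ℕ) : ℤ)
  have hinj : Function.Injective φ := by
    intro y y' h
    funext i
    have := congrFun h i
    simp only [φ] at this
    apply Fin.ext
    omega
  have himg : F ω ∩ box z N = φ '' {y | φ y ∈ F ω} := by
    ext v
    constructor
    · rintro ⟨h1, h2⟩
      have h3 : φ (fun i => ⟨(v i - z i).toNat, by have := h2 i; omega⟩) = v := by
        funext i
        have := h2 i
        simp only [φ]
        omega
      exact ⟨_, by change φ _ ∈ F ω; rw [h3]; exact h1, h3⟩
    · rintro ⟨y, hy, rfl⟩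
      refine ⟨hy, fun i => ?_⟩
      have := (y i).2
      simp only [φ]
      constructor <;> omega
  rw [himg, Set.ncard_image_of_injective _ hinj, Set.ncard_eq_toFinset_card']
  unfold boxAvg
  have hN' : (N : ℝ) ^ d ≠ 0 := by positivity
  rw [← mul_assoc, mul_inv_cancel₀ hN', one_mul]
  have : ∀ y : Fin d → Fin N, ({ω | (0 : Pt d) ∈ F ω}.indicator (fun _ => (1 : ℝ))
      (shift (fun i => ((y i : ℕ) : ℤ)) (shift z ω))) = if φ y ∈ F ω then 1 else 0 := by
    intro y
    rw [shift_shift, Set.indicator_apply]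
    have : (shift (z + fun i => ((y i : ℕ) : ℤ)) ω ∈ {ω | (0 : Pt d) ∈ F ω}) ↔ φ y ∈ F ω := hF _ _
    simp only [this]
  simp only [this]
  rw [Finset.sum_boole]
  congr 2
  ext y
  simp

/-! ### Seed events -/

lemma locUniq1_shift {z : Pt d} {ω : Config d} {s : ℕ} (h : shift z ω ∈ locUniq1 d s) :
    (Sr ω (s : ℝ) ∩ ballZ z s).Nonempty := by
  obtain ⟨y, hy1, hy2⟩ := h
  refine ⟨z + y, (mem_Sr_shift z y ω s).1 hy1, ?_⟩
  rw [mem_ballZ] at hy2 ⊢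
  intro i
  have := hy2 i
  simp only [Pi.zero_apply, Pi.add_apply] at this ⊢
  omega

lemma locUniq2_shift {z : Pt d} {ω : Config d} {R : ℕ} (h : shift z ω ∈ locUniq2 d R) :
    ∀ p ∈ Sr ω ((R : ℝ) / 10) ∩ ballZ z R, ∀ q ∈ Sr ω ((R : ℝ) / 10) ∩ ballZ z R,
      connIn (SS ω ∩ ballZ z (2 * R)) p q := by
  have key : ∀ p ∈ Sr ω ((R : ℝ) / 10) ∩ ballZ z R,
      p - z ∈ Sr (shift z ω) ((R : ℝ) / 10) ∩ ballZ (0 : Pt d) R := by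
    rintro p ⟨hp1, hp2⟩
    refine ⟨(mem_Sr_shift z _ ω _).2 (by simpa using hp1), ?_⟩
    rw [mem_ballZ] at hp2 ⊢
    intro i
    have := hp2 i
    simp only [Pi.zero_apply, Pi.sub_apply]
    omega
  intro p hp q hq
  have h1 := h _ (key p hp) _ (key q hq)
  have h2 := connIn_image (T' := SS ω ∩ ballZ z (2 * R)) z ?_ h1
  · simpa using h2
  · rintro y ⟨hy1, hy2⟩
    refine ⟨hy1, ?_⟩
    rw [mem_ballZ] at hy2 ⊢
    intro i
    have := hy2 i
    simp only [Pi.zero_apply, Pi.add_apply] at this ⊢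
    omega

lemma grid_apply (ω : Config d) (b : Pt d) (s n M : ℕ) (hs : 1 ≤ s) (hn : 9 ≤ n)
    (hM : n ≤ M) (L : ℕ) (hL : n * s ≤ L)
    (H : ∀ m : Fin d → Fin M, shift (fun i => b i + s * ((m i : ℕ) : ℤ)) ω ∈
      locUniq1 d s ∩ locUniq2 d (2 * s))
    {p q : Pt d} (hp : p ∈ Sr ω (s : ℝ)) (hq : q ∈ Sr ω (s : ℝ))
    (hp' : ∀ i, 2 * (s : ℤ) ≤ p i - b i ∧ p i - b i ≤ n * s - 3 * s)
    (hq' : ∀ i, 2 * (s : ℤ) ≤ q i - b i ∧ q i - b i ≤ n * s - 3 * s) :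
    connIn (SS ω ∩ box b L) p q := by
  have hr2 : (((2 * s : ℕ) : ℝ)) / 10 ≤ s := by
    have : (0 : ℝ) ≤ s := by positivity
    push_cast; linarith
  have H' : ∀ m : Pt d, (∀ i, (4 : ℤ) ≤ m i ∧ m i ≤ n - 5) →
      shift (fun i => b i + s * m i) ω ∈ locUniq1 d s ∩ locUniq2 d (2 * s) := by
    intro m hm
    have h := H (fun i => ⟨(m i).toNat, by have := hm i; omega⟩)
    have e : (fun i => b i + s * m i) = (fun i => b i + s * (((m i).toNat : ℕ) : ℤ)) := by
      funext i
      rw [Int.toNat_of_nonneg (by have := hm i; omega)]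
    rw [e]
    exact h
  have hlh : ((n : ℤ) - 5) * s = n * s - 5 * s := by ring
  have hL' : (n : ℤ) * s ≤ L := by exact_mod_cast hL
  refine grid_conn' ω b s hs ((((2 * s : ℕ) : ℝ)) / 10) hr2 4 (n - 5) (by omega)
    (fun m hm => locUniq1_shift (H' m hm).1) ?_ (box b L) ?_ (Sr_anti ω hr2 hp)
    (Sr_anti ω hr2 hq) ?_ ?_
  · intro m hm
    have := locUniq2_shift (H' m hm).2
    rwa [show 2 * (2 * s) = 4 * s by ring] at this
  · intro m hm y hy i
    rw [mem_ballZ] at hy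
    have h1 := hy i
    have h2 : (s : ℤ) * 4 ≤ s * m i := mul_le_mul_of_nonneg_left (hm i).1 (by omega)
    have h3 : (s : ℤ) * m i ≤ s * (n - 5) := mul_le_mul_of_nonneg_left (hm i).2 (by omega)
    have h4 : (s : ℤ) * (n - 5) = n * s - 5 * s := by ring
    omega
  · intro i
    have := hp' i
    rw [hlh]; omega
  · intro i
    have := hq' i
    rw [hlh]; omega

lemma inner_vol (hd : 1 ≤ d) (n s L0 : ℕ) (hn : n = 49 * d) (hL : L0 ≤ n * s + s) (hs : n ≤ s) :
    (6/7 : ℝ) * (L0 : ℝ) ^ d ≤ (((n - 6) * s : ℕ) : ℝ) ^ d := by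
  have hd' : (1 : ℝ) ≤ d := by exact_mod_cast hd
  have hnR : (n : ℝ) = 49 * d := by exact_mod_cast hn
  have hn6 : (((n - 6) * s : ℕ) : ℝ) = ((n : ℝ) - 6) * s := by
    rw [Nat.cast_mul, Nat.cast_sub (by omega)]; norm_num
  have hnpos : (0 : ℝ) < n := by rw [hnR]; linarith
  have hLR : (L0 : ℝ) ≤ n * s + s := by exact_mod_cast hL
  have h1 : (1 - 7 / (n : ℝ)) * L0 ≤ ((n : ℝ) - 6) * s := by
    have h7 : 7 / (n : ℝ) ≤ 1 := by rw [div_le_one hnpos, hnR]; linarith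
    have hs0 : (0 : ℝ) ≤ s := by positivity
    calc (1 - 7 / (n : ℝ)) * L0 ≤ (1 - 7 / (n : ℝ)) * (n * s + s) :=
          mul_le_mul_of_nonneg_left hLR (by linarith)
      _ = ((n : ℝ) - 6) * s - 7 / n * s := by field_simp; ring
      _ ≤ _ := by
        have : 0 ≤ 7 / (n : ℝ) * s := by positivity
        linarith
  have h7 : 7 / (n : ℝ) ≤ 1 := by rw [div_le_one hnpos, hnR]; linarith
  have h2 : (6/7 : ℝ) ≤ (1 - 7 / (n : ℝ)) ^ d := by
    have := one_add_mul_le_pow (a := -(7 / (n : ℝ))) (by linarith) d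
    have e : 1 + (d : ℝ) * -(7 / (n : ℝ)) = 6 / 7 := by
      rw [hnR]; field_simp; ring
    rw [e] at this
    rwa [sub_eq_add_neg]
  rw [hn6]
  calc (6/7 : ℝ) * (L0 : ℝ) ^ d ≤ (1 - 7 / (n : ℝ)) ^ d * (L0 : ℝ) ^ d := by gcongr
    _ = ((1 - 7 / (n : ℝ)) * L0) ^ d := by rw [mul_pow]
    _ ≤ _ := by
      apply pow_le_pow_left₀ _ h1
      have : (0 : ℝ) ≤ 1 - 7 / n := by linarith
      positivity

lemma seed_det (hd : 1 ≤ d) (η : ℝ) (hη : 0 < η) (n s L0 : ℕ) (hn : n = 49 * d)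
    (hL1 : n * s ≤ L0) (hL2 : L0 ≤ n * s + s) (hs : n ≤ s) (x : Pt d) (ω : Config d)
    (H1 : ∀ (e : Fin d → Bool) (m : Fin d → Fin (2 * n)),
      shift (fun i => subCorner x L0 e i + s * ((m i : ℕ) : ℤ)) ω ∈
        locUniq1 d s ∩ locUniq2 d (2 * s))
    (H2 : ∀ e : Fin d → Bool, 7/8 * η < boxAvg {ω | (0 : Pt d) ∈ Sinf ω} ((n - 6) * s)
      (shift (fun i => subCorner x L0 e i + 2 * s) ω))
    (H3 : ∀ i : Fin d, ∃ k : ℕ, k < L0 / 6 ∧ shift (k • unitVec i)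
      (shift (Function.update (fun j => x j + (L0/2 : ℕ)) i (x i + (L0/3 : ℕ))) ω) ∈
        {ω | (0 : Pt d) ∈ Sinf ω}) :
    ω ∈ eventA' d η L0 x := by
  have hn49 : 49 ≤ n := by omega
  have hns : 49 * s ≤ n * s := Nat.mul_le_mul_right s hn49
  have hL1' : (n : ℤ) * s ≤ L0 := by exact_mod_cast hL1
  have hL2' : (L0 : ℤ) ≤ n * s + s := by exact_mod_cast hL2
  have hns' : 49 * (s : ℤ) ≤ n * s := by exact_mod_cast hns
  have hN : (((n - 6) * s : ℕ) : ℤ) = n * s - 6 * s := by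
    rw [Nat.cast_mul, Nat.cast_sub (by omega)]; push_cast; ring
  have hNpos : 1 ≤ (n - 6) * s := by
    have : 0 < (((n - 6) * s : ℕ) : ℤ) := by rw [hN]; omega
    omega
  set N := (n - 6) * s with hNdef
  have hSinf : ∀ y, y ∈ Sinf ω → ∀ M : ℕ, y ∈ Sr ω (M : ℝ) := fun y hy => (mem_Sinf_iff ω y).1 hy
  -- connection in a sub-box
  have conn1 : ∀ e, ∀ p q : Pt d, p ∈ Sinf ω → q ∈ Sinf ω →
      (∀ i, 2 * (s : ℤ) ≤ p i - subCorner x L0 e i ∧ p i - subCorner x L0 e i ≤ n * s - 3 * s) →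
      (∀ i, 2 * (s : ℤ) ≤ q i - subCorner x L0 e i ∧ q i - subCorner x L0 e i ≤ n * s - 3 * s) →
      connIn (Sr ω (L0 : ℝ) ∩ box (subCorner x L0 e) L0) p q := by
    intro e p q hp hq hp' hq'
    apply connIn_Sr (hSinf p hp L0)
    exact grid_apply ω (subCorner x L0 e) s n (2 * n) (by omega) (by omega) (by omega) L0 hL1
      (H1 e) (hSinf p hp s) (hSinf q hq s) hp' hq'
  -- connection in the whole box
  have conn2 : ∀ p q : Pt d, p ∈ Sinf ω → q ∈ Sinf ω →
      (∀ i, 2 * (s : ℤ) ≤ p i - x i ∧ p i - x i ≤ 2 * (n * s) - 3 * s) →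
      (∀ i, 2 * (s : ℤ) ≤ q i - x i ∧ q i - x i ≤ 2 * (n * s) - 3 * s) →
      connIn (SS ω ∩ box x (2 * L0)) p q := by
    intro p q hp hq hp' hq'
    have e2 : ((2 * n : ℕ) : ℤ) * s = 2 * (n * s) := by push_cast; ring
    refine grid_apply ω x s (2 * n) (2 * n) (by omega) (by omega) le_rfl (2 * L0)
      (by rw [mul_assoc]; omega) ?_ (hSinf p hp s) (hSinf q hq s) ?_ ?_
    · have := H1 (fun _ => false)
      rwa [subCorner_false] at this
    · intro i; rw [e2]; exact hp' i
    · intro i; rw [e2]; exact hq' i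
  -- counting
  have hcount : ∀ e, 7/8 * η * (N : ℝ) ^ d <
      ((Sinf ω ∩ box (fun i => subCorner x L0 e i + 2 * s) N).ncard : ℝ) := by
    intro e
    rw [← boxAvg_count Sinf (fun v ω => by rw [mem_Sinf_shift]; simp) N hNpos]
    have hpos : (0 : ℝ) < (N : ℝ) ^ d := by positivity
    rw [mul_comm]
    exact mul_lt_mul_of_pos_left (H2 e) hpos
  have hvol := inner_vol hd n s L0 hn hL2 hs
  rw [← hNdef] at hvol
  have hcount2 : ∀ e, 3/4 * η * (L0 : ℝ) ^ d ≤
      ((Sinf ω ∩ box (fun i => subCorner x L0 e i + 2 * s) N).ncard : ℝ) := by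
    intro e
    refine le_trans ?_ (hcount e).le
    have := mul_le_mul_of_nonneg_left hvol (show (0 : ℝ) ≤ 7/8 * η by positivity)
    linarith
  have hne : ∀ e, (Sinf ω ∩ box (fun i => subCorner x L0 e i + 2 * s) N).Nonempty := by
    intro e
    by_contra hcon
    rw [Set.not_nonempty_iff_eq_empty] at hcon
    have := hcount e
    rw [hcon] at this
    have h0 : 0 ≤ 7/8 * η * (N : ℝ) ^ d := by positivity
    simp at this
    linarith
  choose w hw using hne
  have inner : ∀ e (p : Pt d), p ∈ box (fun i => subCorner x L0 e i + 2 * s) N →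
      ∀ i, 2 * (s : ℤ) ≤ p i - subCorner x L0 e i ∧
        p i - subCorner x L0 e i ≤ n * s - 4 * s := by
    intro e p hp i
    have := hp i
    rw [hN] at this
    dsimp only at this
    omega
  have inner3 : ∀ e (p : Pt d), p ∈ box (fun i => subCorner x L0 e i + 2 * s) N →
      ∀ i, 2 * (s : ℤ) ≤ p i - subCorner x L0 e i ∧
        p i - subCorner x L0 e i ≤ n * s - 3 * s := by
    intro e p hp i
    have := inner e p hp i
    omega
  refine ⟨w, fun e => ?_, fun e => ?_, fun e e' => ?_, fun i => ?_⟩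
  · exact (conn1 e (w e) (w e) (hw e).1 (hw e).1 (inner3 e _ (hw e).2) (inner3 e _ (hw e).2)).1
  · refine (hcount2 e).trans ?_
    have hsub : Sinf ω ∩ box (fun i => subCorner x L0 e i + 2 * s) N ⊆
        cluster (Sr ω (L0 : ℝ) ∩ box (subCorner x L0 e) L0) (w e) := by
      rintro y ⟨hy1, hy2⟩
      exact conn1 e (w e) y (hw e).1 hy1 (inner3 e _ (hw e).2) (inner3 e _ hy2)
    have := Set.ncard_le_ncard hsub ((box_finite (subCorner x L0 e) L0).subset
      (fun y hy => hy.2.1.2))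
    exact_mod_cast this
  · have hb : ∀ e, ∀ i, 2 * (s : ℤ) ≤ w e i - x i ∧ w e i - x i ≤ 2 * (n * s) - 3 * s := by
      intro e i
      have h1 := inner e _ (hw e).2 i
      rcases subCorner_apply x L0 e i with h | h <;> rw [h] at h1 <;> omega
    exact conn2 _ _ (hw e).1 (hw e').1 (hb e) (hb e')
  · obtain ⟨k, hk, hkS⟩ := H3 i
    set base : Pt d := Function.update (fun j => x j + (L0/2 : ℕ)) i (x i + (L0/3 : ℕ)) with hbase
    have hy : base + k • unitVec i ∈ Sinf ω := by
      have h1 : (0 : Pt d) ∈ Sinf (shift (k • unitVec i) (shift base ω)) := hkS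
      rw [shift_shift, mem_Sinf_shift] at h1
      simpa using h1
    have hval_i : (base + k • unitVec i) i = x i + (L0/3 : ℕ) + k := by
      simp [hbase, unitVec]
    have hval_j : ∀ j, j ≠ i → (base + k • unitVec i) j = x j + (L0/2 : ℕ) := by
      intro j hj
      simp [hbase, unitVec, hj]
    have hval : ∀ j, (base + k • unitVec i) j = x j + (L0/2 : ℕ) ∨
        ((base + k • unitVec i) j = x j + (L0/3 : ℕ) + k) := by
      intro j
      by_cases h : j = i
      · subst h; exact Or.inr hval_i
      · exact Or.inl (hval_j j h)
    refine ⟨base + k • unitVec i, ?_, ⟨((L0/3 : ℕ) : ℤ) + k - (L0/2 : ℕ), ?_⟩, ?_⟩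
    · refine conn1 (fun _ => false) _ _ (hw _).1 hy (inner3 _ _ (hw _).2) ?_
      intro j
      rw [subCorner_false]
      rcases hval j with h | h <;> rw [h] <;> omega
    · funext j
      by_cases h : j = i
      · subst h
        rw [hval_i]
        simp [unitVec]
        ring
      · rw [hval_j j h]
        simp [unitVec, h]
    · intro j
      rcases hval j with h | h <;> rw [h] <;> omega

lemma real_preimage_shift {μ : Measure (Config d)}
    (hE : ∀ x : Pt d, x ≠ 0 → Ergodic (shift x) μ) {S : Set (Config d)}
    (hS : NullMeasurableSet S μ) (v : Pt d) : μ.real {ω | shift v ω ∈ S} = μ.real S := by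
  unfold Measure.real
  congr 1
  exact (shift_mp hE v).measure_preimage hS

lemma null_low {μ : Measure (Config d)} [IsProbabilityMeasure μ]
    {A : Set (Config d)} (hA : MeasurableSet A) (n : ℕ) (c : ℝ) :
    NullMeasurableSet {ω | boxAvg A n ω ≤ c} μ :=
  nullMeasurableSet_le (boxAvg_integrable hA n).aemeasurable aemeasurable_const

lemma null_high {μ : Measure (Config d)} [IsProbabilityMeasure μ]
    {A : Set (Config d)} (hA : MeasurableSet A) (n : ℕ) (c : ℝ) :
    NullMeasurableSet {ω | c ≤ boxAvg A n ω} μ :=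
  nullMeasurableSet_le aemeasurable_const (boxAvg_integrable hA n).aemeasurable

lemma meas_line {A : Set (Config d)} (hA : MeasurableSet A) (i : Fin d) (n : ℕ) :
    MeasurableSet {ω : Config d | ∀ k : ℕ, k < n → shift (k • unitVec i) ω ∉ A} := by
  have : {ω : Config d | ∀ k : ℕ, k < n → shift (k • unitVec i) ω ∉ A} =
      ⋂ k : ℕ, ⋂ _ : k < n, (shift (k • unitVec i) ⁻¹' A)ᶜ := by
    ext ω; simp
  rw [this]
  exact MeasurableSet.iInter (fun k => MeasurableSet.iInter
    (fun _ => (measurable_shift _ hA).compl))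

lemma seed_A {μ : Measure (Config d)} [IsProbabilityMeasure μ]
    (hE : ∀ x : Pt d, x ≠ 0 → Ergodic (shift x) μ) (hd : 1 ≤ d) (η : ℝ) (hη : 0 < η)
    (hlow : 7/8 * η < eta d μ)
    (h1 : Tendsto (fun R => μ.real (locUniq1 d R)ᶜ) atTop (nhds 0))
    (h2 : Tendsto (fun R => μ.real (locUniq2 d R)ᶜ) atTop (nhds 0)) (ε : ℝ) (hε : 0 < ε) :
    ∃ C : ℕ, ∀ L0 : ℕ, C ≤ L0 → ∀ x : Pt d, μ.real (eventA' d η L0 x)ᶜ ≤ ε := by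
  set A : Set (Config d) := {ω | (0 : Pt d) ∈ Sinf ω} with hAdef
  have hA : MeasurableSet A := measurableSet_mem_Sinf 0
  have hlow' : 7/8 * η < μ.real A := hlow
  set n := 49 * d with hn
  have hn0 : 0 < n := by omega
  have ts : Tendsto (fun L0 : ℕ => L0 / n) atTop atTop :=
    Nat.tendsto_div_const_atTop hn0.ne'
  have t6 : Tendsto (fun L0 : ℕ => L0 / 6) atTop atTop :=
    Nat.tendsto_div_const_atTop (by norm_num)
  have t2s : Tendsto (fun L0 : ℕ => 2 * (L0 / n)) atTop atTop :=
    ts.const_mul_atTop' (by norm_num)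
  have tN : Tendsto (fun L0 : ℕ => (n - 6) * (L0 / n)) atTop atTop :=
    ts.const_mul_atTop' (by omega)
  have T1 := h1.comp ts
  have T2 := h2.comp t2s
  have T3 := (boxAvg_low hE hA hd _ hlow').comp tN
  have T4 := fun i => (line_empty hE hA i (lt_trans (by positivity) hlow')).comp t6
  have T : Tendsto (fun L0 : ℕ =>
      (∑ _e : Fin d → Bool, ∑ _m : Fin d → Fin (2 * n),
        (μ.real (locUniq1 d (L0 / n))ᶜ + μ.real (locUniq2 d (2 * (L0 / n)))ᶜ)) +
      (∑ _e : Fin d → Bool, μ.real {ω | boxAvg A ((n - 6) * (L0 / n)) ω ≤ 7/8 * η}) +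
      ∑ i : Fin d, μ.real {ω | ∀ k : ℕ, k < L0 / 6 → shift (k • unitVec i) ω ∉ A})
      atTop (nhds 0) := by
    have S1 := tendsto_finsetSum (Finset.univ : Finset (Fin d → Bool)) (fun _ _ =>
      tendsto_finsetSum (Finset.univ : Finset (Fin d → Fin (2 * n))) (fun _ _ => T1.add T2))
    have S2 := tendsto_finsetSum (Finset.univ : Finset (Fin d → Bool)) (fun _ _ => T3)
    have S3 := tendsto_finsetSum (Finset.univ : Finset (Fin d)) (fun i _ => T4 i)
    simpa using (S1.add S2).add S3
  obtain ⟨C, hC⟩ := eventually_atTop.1 (T.eventually (gt_mem_nhds hε))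
  refine ⟨max C (n * n), fun L0 hL0 x => ?_⟩
  refine le_trans ?_ (hC L0 (le_trans (le_max_left _ _) hL0)).le
  have hL0' : n * n ≤ L0 := le_trans (le_max_right _ _) hL0
  set s := L0 / n with hs
  have hns : n ≤ s := (Nat.le_div_iff_mul_le hn0).2 hL0'
  have hdm := Nat.div_add_mod L0 n
  have hmod := Nat.mod_lt L0 hn0
  rw [← hs] at hdm
  let U1 : Set (Config d) := ⋃ e : Fin d → Bool, ⋃ m : Fin d → Fin (2 * n),
    ({ω | shift (fun i => subCorner x L0 e i + s * ((m i : ℕ) : ℤ)) ω ∈ (locUniq1 d s)ᶜ} ∪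
     {ω | shift (fun i => subCorner x L0 e i + s * ((m i : ℕ) : ℤ)) ω ∈ (locUniq2 d (2 * s))ᶜ})
  let U2 : Set (Config d) := ⋃ e : Fin d → Bool,
    {ω | shift (fun i => subCorner x L0 e i + 2 * s) ω ∈
      {ω | boxAvg A ((n - 6) * s) ω ≤ 7/8 * η}}
  let U3 : Set (Config d) := ⋃ i : Fin d,
    {ω | shift (Function.update (fun j => x j + (L0/2 : ℕ)) i (x i + (L0/3 : ℕ))) ω ∈
      {ω | ∀ k : ℕ, k < L0 / 6 → shift (k • unitVec i) ω ∉ A}}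
  have hsub : (eventA' d η L0 x)ᶜ ⊆ U1 ∪ U2 ∪ U3 := by
    intro ω hω
    by_contra hcon
    apply hω
    simp only [Set.mem_union, not_or] at hcon
    obtain ⟨⟨c1, c2⟩, c3⟩ := hcon
    simp only [U1, Set.mem_iUnion, not_exists, Set.mem_union, not_or] at c1
    simp only [U2, Set.mem_iUnion, not_exists] at c2
    simp only [U3, Set.mem_iUnion, not_exists] at c3
    apply seed_det hd η hη n s L0 hn (by omega) (by omega) hns x ω
    · intro e m
      exact ⟨by_contra (c1 e m).1, by_contra (c1 e m).2⟩
    · intro e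
      exact not_le.1 (c2 e)
    · intro i
      by_contra h
      apply c3 i
      intro k hk hkA
      exact h ⟨k, hk, hkA⟩
  have b1 : μ.real U1 ≤ ∑ _e : Fin d → Bool, ∑ _m : Fin d → Fin (2 * n),
        (μ.real (locUniq1 d s)ᶜ + μ.real (locUniq2 d (2 * s))ᶜ) := by
    refine (measureReal_iUnion_fintype_le _).trans (Finset.sum_le_sum fun e _ => ?_)
    refine (measureReal_iUnion_fintype_le _).trans (Finset.sum_le_sum fun m _ => ?_)
    refine (measureReal_union_le _ _).trans (add_le_add ?_ ?_)
    · exact (real_preimage_shift hE (measurableSet_locUniq1 s).compl.nullMeasurableSet _).le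
    · exact (real_preimage_shift hE (measurableSet_locUniq2 _).compl.nullMeasurableSet _).le
  have b2 : μ.real U2 ≤
      ∑ _e : Fin d → Bool, μ.real {ω | boxAvg A ((n - 6) * s) ω ≤ 7/8 * η} := by
    refine (measureReal_iUnion_fintype_le _).trans (Finset.sum_le_sum fun e _ => ?_)
    exact (real_preimage_shift hE (null_low hA _ _) _).le
  have b3 : μ.real U3 ≤
      ∑ i : Fin d, μ.real {ω | ∀ k : ℕ, k < L0 / 6 → shift (k • unitVec i) ω ∉ A} := by
    refine (measureReal_iUnion_fintype_le _).trans (Finset.sum_le_sum fun i _ => ?_)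
    exact (real_preimage_shift hE (meas_line hA i _).nullMeasurableSet _).le
  calc μ.real (eventA' d η L0 x)ᶜ ≤ μ.real (U1 ∪ U2 ∪ U3) :=
        measureReal_mono hsub (measure_ne_top _ _)
    _ ≤ μ.real U1 + μ.real U2 + μ.real U3 :=
        (measureReal_union_le _ _).trans (add_le_add_left (measureReal_union_le _ _) _)
    _ ≤ _ := add_le_add (add_le_add b1 b2) b3

lemma seed_B {μ : Measure (Config d)} [IsProbabilityMeasure μ]
    (hE : ∀ x : Pt d, x ≠ 0 → Ergodic (shift x) μ) (hd : 1 ≤ d) (η : ℝ) (hη : 0 < η)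
    (hhigh : eta d μ < 9/8 * η) (ε : ℝ) (hε : 0 < ε) :
    ∃ C : ℕ, ∀ L0 : ℕ, C ≤ L0 → ∀ x : Pt d, μ.real (eventB d η L0 x)ᶜ ≤ ε := by
  have hanti : Antitone (fun M : ℕ => {ω : Config d | (0 : Pt d) ∈ Sr ω (M : ℝ)}) := by
    intro M M' h ω hω
    exact Sr_anti ω (by exact_mod_cast h) hω
  have hinter : (⋂ M : ℕ, {ω : Config d | (0 : Pt d) ∈ Sr ω (M : ℝ)}) =
      {ω | (0 : Pt d) ∈ Sinf ω} := by
    ext ω; simp [mem_Sinf_iff]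
  have hlim := tendsto_measure_iInter_atTop (μ := μ)
    (fun M => (measurableSet_mem_Sr (0 : Pt d) M).nullMeasurableSet) hanti
    ⟨0, measure_ne_top _ _⟩
  rw [hinter] at hlim
  have hlim' := (ENNReal.tendsto_toReal (measure_ne_top μ {ω | (0 : Pt d) ∈ Sinf ω})).comp hlim
  obtain ⟨M, hM⟩ := (hlim'.eventually (gt_mem_nhds hhigh)).exists
  set A : Set (Config d) := {ω : Config d | (0 : Pt d) ∈ Sr ω (M : ℝ)} with hAdef
  have hA : MeasurableSet A := measurableSet_mem_Sr 0 M
  have hM' : μ.real A < 5/4 * η := lt_trans hM (by linarith)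
  have T3 := boxAvg_high hE hA hd _ hM'
  have T : Tendsto (fun L0 : ℕ => ∑ _e : Fin d → Bool, μ.real {ω | 5/4 * η ≤ boxAvg A L0 ω})
      atTop (nhds 0) := by
    have S2 := tendsto_finsetSum (Finset.univ : Finset (Fin d → Bool)) (fun _ _ => T3)
    simpa using S2
  obtain ⟨C, hC⟩ := eventually_atTop.1 (T.eventually (gt_mem_nhds hε))
  refine ⟨max C (max M 1), fun L0 hL0 x => ?_⟩
  refine le_trans ?_ (hC L0 (le_trans (le_max_left _ _) hL0)).le
  have hLM : M ≤ L0 := le_trans ((le_max_left _ _).trans (le_max_right _ _)) hL0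
  have hL1 : 1 ≤ L0 := le_trans ((le_max_right _ _).trans (le_max_right _ _)) hL0
  have hsub : (eventB d η L0 x)ᶜ ⊆ ⋃ e : Fin d → Bool,
      {ω | shift (subCorner x L0 e) ω ∈ {ω | 5/4 * η ≤ boxAvg A L0 ω}} := by
    intro ω hω
    by_contra hcon
    apply hω
    simp only [Set.mem_iUnion, not_exists] at hcon
    intro e
    have h1 : boxAvg A L0 (shift (subCorner x L0 e) ω) < 5/4 * η := not_le.1 (hcon e)
    have h2 := boxAvg_count (fun ω => Sr ω (M : ℝ)) (fun v ω => by rw [mem_Sr_shift]; simp)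
      L0 hL1 (subCorner x L0 e) ω
    have hpos : (0 : ℝ) < (L0 : ℝ) ^ d := by positivity
    have h3 : ((Sr ω (L0 : ℝ) ∩ box (subCorner x L0 e) L0).ncard : ℝ) ≤
        ((Sr ω (M : ℝ) ∩ box (subCorner x L0 e) L0).ncard : ℝ) := by
      have := Set.ncard_le_ncard (Set.inter_subset_inter_left (box (subCorner x L0 e) L0)
        (Sr_anti ω (show (M : ℝ) ≤ L0 by exact_mod_cast hLM)))
        ((box_finite (subCorner x L0 e) L0).subset Set.inter_subset_right)
      exact_mod_cast this
    refine h3.trans ?_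
    rw [← h2, mul_comm]
    exact (mul_le_mul_of_nonneg_right h1.le hpos.le)
  refine (measureReal_mono hsub (measure_ne_top _ _)).trans ?_
  refine (measureReal_iUnion_fintype_le _).trans (Finset.sum_le_sum fun e _ => ?_)
  exact (real_preimage_shift hE (null_high hA _ _) _).le

/-! ### Assembling the proof -/

lemma exp_fS_tendsto (f : ℕ → ℝ) (Δ : ℝ) (hΔ : 0 < Δ) (R0 : ℕ)
    (hf : ∀ R : ℕ, R0 ≤ R → (Real.log R) ^ (1 + Δ) ≤ f R) :
    Tendsto (fun R => Real.exp (-(f R))) atTop (nhds 0) := by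
  have h1 : Tendsto (fun R : ℕ => (Real.log R) ^ (1 + Δ)) atTop atTop :=
    (tendsto_rpow_atTop (by linarith)).comp
      (Real.tendsto_log_atTop.comp tendsto_natCast_atTop_atTop)
  have h2 : Tendsto f atTop atTop := tendsto_atTop_mono' atTop
    (eventually_atTop.2 ⟨R0, fun R hR => hf R hR⟩) h1
  exact Real.tendsto_exp_neg_atTop_nhds_zero.comp h2

lemma compl_tendsto {μ : Measure (Config d)} [IsProbabilityMeasure μ] (E : ℕ → Set (Config d))
    (hE : ∀ R, MeasurableSet (E R)) (g : ℕ → ℝ) (hg : Tendsto g atTop (nhds 0))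
    (h : ∀ R, 1 ≤ R → 1 - g R ≤ (μ (E R)).toReal) :
    Tendsto (fun R => μ.real (E R)ᶜ) atTop (nhds 0) := by
  refine squeeze_zero' (Eventually.of_forall (fun _ => measureReal_nonneg)) ?_ hg
  refine eventually_atTop.2 ⟨1, fun R hR => ?_⟩
  rw [probReal_compl_eq_one_sub (hE R)]
  have : 1 - g R ≤ μ.real (E R) := h R hR
  linarith

lemma mono_dec {a b : ℝ} {P : ℝ → Measure (Config d)} (Ax : Axioms d a b P) {v u : ℝ}
    (hv : v ∈ Set.Ioo a b) (hu : u ∈ Set.Ioo a b) (hvu : v ≤ u) {G : Set (Config d)}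
    (hG : MeasurableSet G) (hdec : DecreasingEvent G) : (P u G).toReal ≤ (P v G).toReal := by
  haveI := Ax.prob v hv
  haveI := Ax.prob u hu
  have h1 : P v Gᶜ ≤ P u Gᶜ := Ax.mono v hv u hu hvu Gᶜ hG.compl
    (fun ω ω' h hω hω' => hω (hdec ω' ω h hω'))
  have h2 : (P v).real Gᶜ ≤ (P u).real Gᶜ := ENNReal.toReal_mono (measure_ne_top _ _) h1
  rw [probReal_compl_eq_one_sub hG, probReal_compl_eq_one_sub hG] at h2
  change (P u).real G ≤ (P v).real G
  linarith

lemma mono_inc {a b : ℝ} {P : ℝ → Measure (Config d)} (Ax : Axioms d a b P) {v u : ℝ}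
    (hv : v ∈ Set.Ioo a b) (hu : u ∈ Set.Ioo a b) (huv : u ≤ v) {G : Set (Config d)}
    (hG : MeasurableSet G) (hinc : IncreasingEvent G) : (P u G).toReal ≤ (P v G).toReal := by
  haveI := Ax.prob v hv
  exact ENNReal.toReal_mono (measure_ne_top _ _) (Ax.mono u hu v hv huv G hG hinc)

lemma exists_sprinkled {a b : ℝ} {P : ℝ → Measure (Config d)} (Ax : Axioms d a b P) {u : ℝ}
    (hu : u ∈ Set.Ioo a b) :
    ∃ um up : ℝ, a < um ∧ um < u ∧ u < up ∧ up < b ∧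
      7/8 * eta d (P u) < eta d (P um) ∧ eta d (P up) < 9/8 * eta d (P u) := by
  have hpos := Ax.S2pos u hu
  have hc : ContinuousAt (fun u => eta d (P u)) u :=
    Ax.S2cont.continuousAt (Ioo_mem_nhds hu.1 hu.2)
  have e1 : ∀ᶠ v in nhds u, 7/8 * eta d (P u) < eta d (P v) :=
    hc.eventually (lt_mem_nhds (by linarith))
  have e2 : ∀ᶠ v in nhds u, eta d (P v) < 9/8 * eta d (P u) :=
    hc.eventually (gt_mem_nhds (by linarith))
  obtain ⟨um, h1, h2⟩ := ((e1.filter_mono nhdsWithin_le_nhds).and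
    (Ioo_mem_nhdsLT hu.1)).exists
  obtain ⟨up, h3, h4⟩ := ((e2.filter_mono nhdsWithin_le_nhds).and
    (Ioo_mem_nhdsGT hu.2)).exists
  exact ⟨um, up, h2.1, h2.2, h4.1, h4.2, h1, h3⟩

lemma final_arith (K : ℝ) (hK : 1 ≤ K) (M : ℕ) :
    ((M : ℝ) + 1) * (K ^ M * (1 / (4 * K)) ^ M) ≤ 2 * (2⁻¹ : ℝ) ^ M := by
  have hK0 : K ≠ 0 := by positivity
  rw [← mul_pow, show K * (1 / (4 * K)) = 2⁻¹ * 2⁻¹ by field_simp; norm_num, mul_pow, ← mul_assoc]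
  apply mul_le_mul_of_nonneg_right _ (by positivity)
  have h1 : (M : ℝ) + 1 ≤ 2 ^ M := by
    exact_mod_cast Nat.succ_le_of_lt (Nat.lt_two_pow_self (n := M))
  calc ((M : ℝ) + 1) * 2⁻¹ ^ M ≤ 2 ^ M * 2⁻¹ ^ M := by gcongr
    _ = 1 := by rw [← mul_pow]; norm_num
    _ ≤ 2 := by norm_num

lemma pow_half (t : ℝ) (ht0 : 0 ≤ t) (ht1 : t ≤ 1) {m M : ℕ} (h : M ≤ 2 * m) :
    (t ^ 2) ^ m ≤ t ^ M := by
  rw [← pow_mul]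
  exact pow_le_pow_of_le_one ht0 ht1 h

lemma sum_bound {μ : Measure (Config d)} [IsProbabilityMeasure μ] {r0 l0 L0 θ k : ℕ}
    {D I : Pt d → Set (Config d)} {G : Set (Config d)}
    (hG : G ⊆ cascade d r0 l0 L0 θ (fun x => D x ∪ I x) k 0)
    (K : ℝ) (hK : 1 ≤ K) (hcc : cc d l0 θ k ≤ K ^ (2 ^ k))
    (hD : ∀ m, μ.real (EE d r0 l0 L0 θ D k 0 m) ≤ cc d l0 θ k * ((1 / (4 * K)) ^ 2) ^ m)
    (hI : ∀ m, μ.real (EE d r0 l0 L0 θ I k 0 m) ≤ cc d l0 θ k * ((1 / (4 * K)) ^ 2) ^ m) :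
    μ.real G ≤ 2 * (2⁻¹ : ℝ) ^ (2 ^ k) := by
  set t : ℝ := 1 / (4 * K) with ht
  have ht0 : 0 ≤ t := by positivity
  have ht1 : t ≤ 1 := by
    rw [ht, div_le_one (by positivity)]; linarith
  have hsub : G ⊆ ⋃ m : Fin (2 ^ k + 1),
      (EE d r0 l0 L0 θ D k 0 m ∩ EE d r0 l0 L0 θ I k 0 (2 ^ k - m)) := by
    intro ω hω
    obtain ⟨m, m', hm, h1, h2⟩ := cascade_union_subset k 0 ω (hG hω)
    rw [Set.mem_iUnion]
    refine ⟨⟨m, by omega⟩, h1, ?_⟩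
    have : 2 ^ k - m = m' := by omega
    simpa [this] using h2
  have hterm : ∀ m : Fin (2 ^ k + 1),
      μ.real (EE d r0 l0 L0 θ D k 0 m ∩ EE d r0 l0 L0 θ I k 0 (2 ^ k - m)) ≤
        K ^ (2 ^ k) * t ^ (2 ^ k) := by
    intro m
    have key : ∀ j : ℕ, 2 ^ k ≤ 2 * j → cc d l0 θ k * (t ^ 2) ^ j ≤ K ^ (2 ^ k) * t ^ (2 ^ k) :=
      fun j hj => mul_le_mul hcc (pow_half t ht0 ht1 hj) (by positivity) (by positivity)
    by_cases h : 2 ^ k ≤ 2 * (m : ℕ)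
    · exact (measureReal_mono Set.inter_subset_left (measure_ne_top _ _)).trans
        ((hD m).trans (key m h))
    · exact (measureReal_mono Set.inter_subset_right (measure_ne_top _ _)).trans
        ((hI _).trans (key _ (by omega)))
  calc μ.real G ≤ _ := measureReal_mono hsub (measure_ne_top _ _)
    _ ≤ _ := measureReal_iUnion_fintype_le _
    _ ≤ ∑ _m : Fin (2 ^ k + 1), K ^ (2 ^ k) * t ^ (2 ^ k) := Finset.sum_le_sum fun m _ => hterm m
    _ = (((2 ^ k : ℕ) : ℝ) + 1) * (K ^ (2 ^ k) * t ^ (2 ^ k)) := by simp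
    _ ≤ _ := final_arith K hK (2 ^ k)

lemma kBadMod_subset {η : ℝ} (hη : 0 < η) {L0 : ℕ} (hL0 : 1 ≤ L0) (r0 l0 θ k : ℕ) (x : Pt d) :
    kBadMod d η r0 l0 L0 θ k x ⊆
      cascade d r0 l0 L0 θ (fun x => (eventA' d η L0 x)ᶜ ∪ (eventB d η L0 x)ᶜ) k x := by
  apply Set.union_subset
  · apply cascade_mono
    intro x
    rw [← Set.compl_inter]
    exact Set.compl_subset_compl.2 (A'_inter_B_subset hη hL0 x)
  · apply cascade_mono
    intro x
    exact Set.subset_union_right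

/-- Under P1–P3 and S1–S2, the modified renormalization (with the additional
axis-crossing condition (c) in the seed events) still satisfies
`P^u[0 is k-bad] ≤ 2·2^{−2^k}` for suitable constants `C(u)` and `C'(u,l_0)`. -/
theorem stmt14 (d : ℕ) (hd : 2 ≤ d) (a b : ℝ) (ha : 0 ≤ a) (hab : a < b)
    (P : ℝ → Measure (Config d)) (Ax : Axioms d a b P) :
    ∀ u ∈ Set.Ioo a b,
      ∃ C : ℕ, ∃ C' : ℕ → ℕ,
        ∀ l0 r0 L0 : ℕ, C ≤ l0 → C ≤ r0 → C' l0 ≤ L0 →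
          ∀ k : ℕ,
            (P u (kBadMod d (eta d (P u)) r0 l0 L0 ⌈1/Ax.εP⌉₊ k (0 : Pt d))).toReal ≤
              2 * (2⁻¹ : ℝ) ^ (2 ^ k) := by
  intro u hu
  obtain ⟨um, up, ham, hmu, hup, hpb, hetam, hetap⟩ := exists_sprinkled Ax hu
  have hη := Ax.S2pos u hu
  set η := eta d (P u) with hηdef
  have hum0 : 0 < um := lt_of_le_of_lt ha ham
  have hu0 : 0 < u := hum0.trans hmu
  have hup0 : 0 < up := hu0.trans hup
  have humI : um ∈ Set.Ioo a b := ⟨ham, hmu.trans hu.2⟩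
  have hupI : up ∈ Set.Ioo a b := ⟨hu.1.trans hup, hpb⟩
  have hprobu := Ax.prob u hu
  have hprobm := Ax.prob um humI
  have hprobp := Ax.prob up hupI
  set θ := ⌈1/Ax.εP⌉₊ with hθ
  have hθ1 : 1 ≤ θ := Nat.one_le_ceil_iff.2 (one_div_pos.2 Ax.εP_pos)
  have hδ1 : 0 < Real.log (u / um) := Real.log_pos ((one_lt_div hum0).2 hmu)
  have hδ2 : 0 < Real.log (up / u) := Real.log_pos ((one_lt_div hu0).2 hup)
  obtain ⟨C1, hC1⟩ := sprinkle Ax.χP Ax.χP_pos θ hθ1 _ (lt_min hδ1 hδ2)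
  have hS := exp_fS_tendsto (Ax.fS um) (Ax.ΔS um) (Ax.ΔS_pos um humI) (Ax.RS um)
    (Ax.fS_lb um humI)
  have hl1 := compl_tendsto (μ := P um) (fun R => locUniq1 d R)
    (fun R => measurableSet_locUniq1 R) _ hS (Ax.S1a um humI)
  have hl2 := compl_tendsto (μ := P um) (fun R => locUniq2 d R)
    (fun R => measurableSet_locUniq2 R) _ hS (Ax.S1b um humI)
  have main : ∀ l0 : ℕ, ∃ C' : ℕ, 2 ≤ l0 → ∃ K : ℝ, 1 ≤ K ∧ (∀ k, cc d l0 θ k ≤ K ^ (2 ^ k)) ∧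
      ∀ L0 : ℕ, C' ≤ L0 → 1 ≤ L0 ∧
        (∀ k : ℕ, Real.exp (-(Ax.fP (LSc l0 L0 θ k))) ≤ ((1 / (4 * K)) ^ 2) ^ (2 ^ (k + 1))) ∧
        (∀ x : Pt d, (P um).real (eventA' d η L0 x)ᶜ ≤ (1 / (4 * K)) ^ 2) ∧
        (∀ x : Pt d, (P up).real (eventB d η L0 x)ᶜ ≤ (1 / (4 * K)) ^ 2) := by
    intro l0
    by_cases hl : 2 ≤ l0
    · obtain ⟨K, hK, hcc⟩ := cc_bound d l0 θ (by omega)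
      have hq : 0 < (1 / (4 * K)) ^ 2 := by positivity
      obtain ⟨c1, h1⟩ := err_bound Ax.εP Ax.εP_pos Ax.LP Ax.fP Ax.fP_lb l0 (by omega) _ hq
      obtain ⟨c2, h2⟩ := seed_A (Ax.ergodic um humI) (by omega) η hη hetam hl1 hl2 _ hq
      obtain ⟨c3, h3⟩ := seed_B (Ax.ergodic up hupI) (by omega) η hη hetap _ hq
      refine ⟨1 + c1 + c2 + c3, fun _ => ⟨K, hK, hcc, fun L0 hL => ⟨by omega, ?_, ?_, ?_⟩⟩⟩
      · exact h1 L0 (by omega)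
      · exact h2 L0 (by omega)
      · exact h3 L0 (by omega)
    · exact ⟨0, fun h => absurd h hl⟩
  choose C' hC' using main
  refine ⟨2 + Ax.RP + C1, C', ?_⟩
  intro l0 r0 L0 hl0 hr0 hL0 k
  have hl2' : 2 ≤ l0 := by omega
  obtain ⟨K, hK, hcc, hrest⟩ := hC' l0 hl2'
  obtain ⟨hL1, herr, hsA, hsB⟩ := hrest L0 hL0
  have hrge : ∀ j, r0 ≤ rSc r0 θ j := fun j => Nat.le_mul_of_pos_right _ (by positivity)
  -- sprinkling products
  set pr : ℕ → ℝ := fun k => ∏ j ∈ Finset.range k, (1 + (rSc r0 θ j : ℝ) ^ (-Ax.χP)) with hpr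
  have hfac : ∀ j, 0 < (rSc r0 θ j : ℝ) ^ (-Ax.χP) := fun j => by
    apply Real.rpow_pos_of_pos
    have := hrge j
    exact_mod_cast (by omega : 0 < rSc r0 θ j)
  have hprs : ∀ k, pr (k + 1) = pr k * (1 + (rSc r0 θ k : ℝ) ^ (-Ax.χP)) := fun k =>
    Finset.prod_range_succ _ _
  have hpr1 : ∀ k, 1 ≤ pr k := by
    intro k
    induction k with
    | zero => simp [hpr]
    | succ k ih =>
      rw [hprs]
      have := hfac k
      nlinarith
  have hprle : ∀ k, pr k ≤ Real.exp (min (Real.log (u / um)) (Real.log (up / u))) :=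
    hC1 r0 (by omega)
  have hprm : ∀ k, pr k ≤ u / um := fun k => (hprle k).trans (by
    rw [← Real.exp_log (div_pos hu0 hum0)]
    exact Real.exp_le_exp.2 (by rw [Real.exp_log (div_pos hu0 hum0)]; exact min_le_left _ _))
  have hprp : ∀ k, pr k ≤ up / u := fun k => (hprle k).trans (by
    rw [← Real.exp_log (div_pos hup0 hu0)]
    exact Real.exp_le_exp.2 (by rw [Real.exp_log (div_pos hup0 hu0)]; exact min_le_right _ _))
  have hpr0 : ∀ k, 0 < pr k := fun k => lt_of_lt_of_le one_pos (hpr1 k)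
  set vm : ℕ → ℝ := fun k => um * pr k with hvm
  set vp : ℕ → ℝ := fun k => up / pr k with hvp
  have hvm_le : ∀ k, vm k ≤ u := fun k => by
    have := (le_div_iff₀ hum0).1 (hprm k)
    simp only [hvm]; linarith
  have hvm_ge : ∀ k, um ≤ vm k := fun k => le_mul_of_one_le_right hum0.le (hpr1 k)
  have hvp_ge : ∀ k, u ≤ vp k := fun k => by
    have := (le_div_iff₀ hu0).1 (hprp k)
    simp only [hvp]
    rw [le_div_iff₀ (hpr0 k)]; linarith
  have hvp_le : ∀ k, vp k ≤ up := fun k => div_le_self hup0.le (hpr1 k)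
  have hvmI : ∀ k, vm k ∈ Set.Ioo a b := fun k =>
    ⟨ham.trans_le (hvm_ge k), (hvm_le k).trans_lt hu.2⟩
  have hvpI : ∀ k, vp k ∈ Set.Ioo a b := fun k =>
    ⟨hu.1.trans_le (hvp_ge k), (hvp_le k).trans_lt hpb⟩
  have hvms : ∀ k, vm (k + 1) = (1 + (rSc r0 θ k : ℝ) ^ (-Ax.χP)) * vm k := fun k => by
    simp only [hvm]; rw [hprs]; ring
  have hvps : ∀ k, vp k = (1 + (rSc r0 θ k : ℝ) ^ (-Ax.χP)) * vp (k + 1) := fun k => by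
    have h1 := hpr0 k
    have h2 := hfac k
    have h3 : (1 + (rSc r0 θ k : ℝ) ^ (-Ax.χP)) ≠ 0 := by positivity
    simp only [hvp]; rw [hprs]
    field_simp
  have hvm0 : ∀ k, 0 < vm k := fun k => hum0.trans_le (hvm_ge k)
  have hvp0 : ∀ k, 0 < vp k := fun k => hu0.trans_le (hvp_ge k)
  have hvmlt : ∀ k, vm k < vm (k + 1) := fun k => by
    rw [hvms]; nlinarith [hfac k, hvm0 k, mul_pos (hfac k) (hvm0 k)]
  have hvplt : ∀ k, vp (k + 1) < vp k := fun k => by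
    rw [hvps k]; nlinarith [hfac k, hvp0 (k + 1), mul_pos (hfac k) (hvp0 (k + 1))]
  have hpm : ∀ k, IsProbabilityMeasure (P (vm k)) := fun k => Ax.prob _ (hvmI k)
  have hpp : ∀ k, IsProbabilityMeasure (P (vp k)) := fun k => Ax.prob _ (hvpI k)
  have hq0 : (0 : ℝ) ≤ (1 / (4 * K)) ^ 2 := by positivity
  have hq1 : (1 / (4 * K)) ^ 2 ≤ (1 : ℝ) := by
    apply pow_le_one₀ (by positivity)
    rw [div_le_one (by positivity)]; linarith
  have hLk : ∀ k, 1 ≤ LSc l0 L0 θ k := fun k => hL1.trans (LSc_ge (by omega) θ k)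
  have hRk : ∀ k, Ax.RP ≤ rSc r0 θ k := fun k => le_trans (by omega) (hrge k)
  have hdepD : ∀ x : Pt d, DependsOn (eventA' d η L0 x)ᶜ (ballZ x (3 * L0)) :=
    fun x => (eventA'_dep η L0 x).compl
  have hdepI : ∀ x : Pt d, DependsOn (eventB d η L0 x)ᶜ (ballZ x (3 * L0)) :=
    fun x => (eventB_dep η L0 x).compl
  have hupD : ∀ x : Pt d, UpSet (fun ω ω' : Config d => ∀ x, ω' x = true → ω x = true)
      (eventA' d η L0 x)ᶜ :=
    fun x ω ω' h hω hω' => hω (eventA'_inc η L0 x ω' ω h hω')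
  have hupI' : ∀ x : Pt d, UpSet (fun ω ω' : Config d => ∀ x, ω x = true → ω' x = true)
      (eventB d η L0 x)ᶜ :=
    fun x ω ω' h hω hω' => hω (eventB_dec η L0 x ω' ω h hω')
  have hvm00 : vm 0 = um := by simp [hvm, hpr]
  have hvp00 : vp 0 = up := by simp [hvp, hpr]
  have BD := EE_bound (r0 := r0) (θ := θ) hl2' hL1 hdepD hupD (fun k => P (vm k))
    (fun k => Real.exp (-(Ax.fP (LSc l0 L0 θ k)))) _ hq0 hq1
    (fun k x₁ x₂ hx A₁ A₂ m1 m2 u1 u2 d1 d2 =>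
      Ax.decoupleDec (rSc r0 θ k) (LSc l0 L0 θ k) (hRk k) (hLk k) x₁ x₂ hx (vm (k + 1)) (vm k)
        (hvmI k) (hvmI (k + 1)) (hvmlt k) (hvms k).ge A₁ A₂ m1 m2 u1 u2 d1 d2) herr
    (fun x => by
      change (P (vm 0)).real _ ≤ _
      rw [hvm00]; exact hsA x)
  have BI := EE_bound (r0 := r0) (θ := θ) hl2' hL1 hdepI hupI' (fun k => P (vp k))
    (fun k => Real.exp (-(Ax.fP (LSc l0 L0 θ k)))) _ hq0 hq1
    (fun k x₁ x₂ hx A₁ A₂ m1 m2 u1 u2 d1 d2 =>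
      Ax.decoupleInc (rSc r0 θ k) (LSc l0 L0 θ k) (hRk k) (hLk k) x₁ x₂ hx (vp k) (vp (k + 1))
        (hvpI (k + 1)) (hvpI k) (hvplt k) (hvps k).ge A₁ A₂ m1 m2 u1 u2 d1 d2) herr
    (fun x => by
      change (P (vp 0)).real _ ≤ _
      rw [hvp00]; exact hsB x)
  refine sum_bound (μ := P u) (kBadMod_subset hη hL1 r0 l0 θ k 0) K hK (hcc k)
    (fun m => ?_) (fun m => ?_)
  · exact (mono_dec Ax (hvmI k) hu (hvm_le k) (EE_meas hl2' hdepD k 0 m)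
      (EE_up hupD k 0 m)).trans (BD k 0 m)
  · exact (mono_inc Ax (hvpI k) hu (hvp_ge k) (EE_meas hl2' hdepI k 0 m)
      (EE_up hupI' k 0 m)).trans (BI k 0 m)

end Perco
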